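/- Let g(x) = (1/20)·(x + 1)·(x − 179)·(x³ − 12x² + 648x − 464)³ − (x + 1)·(7x⁷ − 132x⁶ + 6912x⁵ − 74352x⁴ + 822272x³ − 1104000x² − 22464000x − 24883200)·t − x⁵·(x − 8)·t², a polynomial of degree 11 in x with coefficients in ℚ(t). Then the Galois group of (the splitting field of) g over ℚ(t) is a simple group of cardinality 7920 (i.e., it is isomorphic to the Mathieu group M₁₁). -/

import Mathlib

open Polynomial

/-- The generator `t` of the rational function field `ℚ(t)`. -/
noncomputable def t : RatFunc ℚ := RatFunc.X

/-- `g(x) = (1/20)(x+1)(x−179)(x³−12x²+648x−464)³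
  − (x+1)(7x⁷−132x⁶+6912x⁵−74352x⁴+822272x³−1104000x²−22464000x−24883200)·t
  − x⁵(x−8)·t²` over `ℚ(t)`. -/
noncomputable def g : Polynomial (RatFunc ℚ) :=
  C (1 / 20 : RatFunc ℚ) * (X + 1) * (X - 179) *
      (X ^ 3 - 12 * X ^ 2 + 648 * X - 464) ^ 3 -
    C t * ((X + 1) *
      (7 * X ^ 7 - 132 * X ^ 6 + 6912 * X ^ 5 - 74352 * X ^ 4 + 822272 * X ^ 3 -
        1104000 * X ^ 2 - 22464000 * X - 24883200)) -
    C t ^ 2 * (X ^ 5 * (X - 8))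


set_option linter.style.haveILetI false
open Equiv in
lemma perm5 {Z : Type*} [Fintype Z] [DecidableEq Z] (hZ : Fintype.card Z = 5)
    (H : Subgroup (Equiv.Perm Z)) (hH : H ≠ ⊤) (h3 : 3 ∣ Nat.card H) (h5 : 5 ∣ Nat.card H) :
    H = alternatingGroup Z := by
  haveI : Fact (Nat.Prime 3) := ⟨by norm_num⟩
  haveI : Fact (Nat.Prime 5) := ⟨by norm_num⟩
  obtain ⟨a, ha⟩ := exists_prime_orderOf_dvd_card' (G := H) 3 h3
  obtain ⟨b, hb⟩ := exists_prime_orderOf_dvd_card' (G := H) 5 h5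
  have ha' : orderOf (a : Perm Z) = 3 := by rw [Subgroup.orderOf_coe]; exact ha
  have hb' : orderOf (b : Perm Z) = 5 := by rw [Subgroup.orderOf_coe]; exact hb
  have hac : (a : Perm Z).IsCycle := Perm.isCycle_of_prime_order' (by rw [ha']; norm_num)
    (by rw [ha', hZ]; norm_num)
  have hbc : (b : Perm Z).IsCycle := Perm.isCycle_of_prime_order' (by rw [hb']; norm_num)
    (by rw [hb', hZ]; norm_num)
  have ha3 : (a : Perm Z).IsThreeCycle := by
    rw [← card_support_eq_three_iff, ← hac.orderOf, ha']
  have hbs : (b : Perm Z).support = Finset.univ := by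
    rw [← Finset.card_eq_iff_eq_univ, ← hbc.orderOf, hb', hZ]
  have htr : MulAction.IsPretransitive H Z := by
    refine ⟨fun x y => ?_⟩
    have hx : (b : Perm Z) x ≠ x := by rw [← Perm.mem_support, hbs]; simp
    have hy : (b : Perm Z) y ≠ y := by rw [← Perm.mem_support, hbs]; simp
    obtain ⟨i, hi⟩ := hbc.exists_zpow_eq hx hy
    exact ⟨b ^ i, by rw [← hi]; rfl⟩
  have hpp : MulAction.IsPreprimitive H Z :=
    MulAction.IsPreprimitive.of_prime_card (by rw [Nat.card_eq_fintype_card, hZ]; norm_num)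
  have hle := Perm.alternatingGroup_le_of_isPreprimitive_of_isThreeCycle_mem hpp ha3 a.2
  haveI : Nontrivial Z := Fintype.one_lt_card_iff_nontrivial.mp (by omega)
  have hdvd := Subgroup.card_dvd_of_le hle
  have hc2 : Nat.card (alternatingGroup Z) = 60 := by
    rw [nat_card_alternatingGroup, Nat.card_eq_fintype_card, hZ]; rfl
  have hcd := Subgroup.card_subgroup_dvd_card H
  rw [Nat.card_perm, Nat.card_eq_fintype_card (α := Z), hZ] at hcd
  norm_num [Nat.factorial] at hcd
  rw [hc2] at hdvd
  have hcp : Nat.card H = 60 ∨ Nat.card H = 120 := by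
    obtain ⟨k, hk⟩ := hdvd
    have hle := Nat.le_of_dvd (by norm_num) hcd
    have : 0 < Nat.card H := Nat.card_pos
    have hk1 : k = 1 ∨ k = 2 := by omega
    rcases hk1 with rfl | rfl <;> omega
  rcases hcp with h | h
  · exact (Subgroup.eq_of_le_of_card_ge hle (by rw [h, hc2])).symm
  · exact absurd (Subgroup.eq_top_of_card_eq H (by
      rw [h, Nat.card_perm, Nat.card_eq_fintype_card (α := Z), hZ]; rfl)) hH

lemma lemD {D X Y : Type*} [Group D] [Finite D] [MulAction D X] [MulAction D Y]
    [Fintype X] [Fintype Y] [DecidableEq X] [DecidableEq Y]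
    (hX : Fintype.card X = 11) (hY : Fintype.card Y = 12)
    (e : X → Y → ℤ) (he : ∀ x y, e x y = 1 ∨ e x y = -1)
    (y1 y2 : Y) (h12 : y1 ≠ y2) (he1 : ∀ x, e x y1 = 1)
    (hrow : ∀ y y', y ≠ y' → ∑ x, e x y * e x y' = -1)
    (hcs : ∀ x, ∑ y, e x y = 0)
    (hcol : ∀ x x', x ≠ x' → ∑ y, e x y * e x' y = 0)
    (hinv : ∀ (s : D) x y, e (s • x) (s • y) = e x y)
    (hfaith : ∀ s : D, (∀ y : Y, s • y = y) → s = 1)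
    (hy1 : ∀ s : D, s • y1 = y1) (hy2 : ∀ s : D, s • y2 = y2)
    (h3 : 3 ∣ Nat.card D) (h5 : 5 ∣ Nat.card D) :
    Nat.card D = 60 ∧ IsSimpleGroup D := by
  classical
  have hrs : ∀ y, y1 ≠ y → ∑ x, e x y = -1 := by
    intro y hy
    have := hrow y1 y hy
    simpa [he1] using this
  have hsq : ∀ x y, e x y * e x y = 1 := by
    intro x y; rcases he x y with h | h <;> rw [h] <;> norm_num
  have hge : ∀ x y, -1 ≤ e x y ∧ e x y ≤ 1 := by
    intro x y; rcases he x y with h | h <;> rw [h] <;> norm_num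
  -- the sets
  set A : Finset X := Finset.univ.filter (fun x => e x y2 = 1) with hA
  set B : Finset X := Finset.univ.filter (fun x => ¬ e x y2 = 1) with hB
  have hBe : ∀ x ∈ B, e x y2 = -1 := by
    intro x hx
    rw [hB, Finset.mem_filter] at hx
    exact (he x y2).resolve_left hx.2
  have hAe : ∀ x ∈ A, e x y2 = 1 := by
    intro x hx
    rw [hA, Finset.mem_filter] at hx
    exact hx.2
  have hsplit : ∀ f : X → ℤ, ∑ x ∈ A, f x + ∑ x ∈ B, f x = ∑ x, f x := by
    intro f
    exact Finset.sum_filter_add_sum_filter_not _ _ _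
  have hcAB : (A.card : ℤ) + B.card = 11 := by
    have := hsplit (fun _ => 1)
    simpa [hX] using this
  have hdAB : (A.card : ℤ) - B.card = -1 := by
    have := hsplit (fun x => e x y2)
    rw [hrs y2 h12, Finset.sum_congr rfl hAe, Finset.sum_congr rfl hBe] at this
    simp at this
    linarith
  have hAc : A.card = 5 := by omega
  have hBc : B.card = 6 := by omega
  have hsA : ∀ y, y ≠ y1 → y ≠ y2 → ∑ x ∈ A, e x y = -1 ∧ ∑ x ∈ B, e x y = 0 := by
    intro y hya hyb
    have h1 := hsplit (fun x => e x y)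
    have h2 := hsplit (fun x => e x y2 * e x y)
    rw [hrs y hya.symm] at h1
    rw [hrow y2 y hyb.symm] at h2
    rw [Finset.sum_congr rfl (fun x hx => by rw [hAe x hx, one_mul] : ∀ x ∈ A, e x y2 * e x y = e x y),
      Finset.sum_congr rfl (fun x hx => by rw [hBe x hx, neg_one_mul] : ∀ x ∈ B, e x y2 * e x y = - e x y),
      Finset.sum_neg_distrib] at h2
    constructor <;> linarith
  -- the third row
  have huniq : ∀ c d, c ≠ d → c ∈ A → d ∈ A → ∀ y y', y ≠ y1 → y ≠ y2 → y' ≠ y1 → y' ≠ y2 →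
      e c y = 1 → e d y = 1 → e c y' = 1 → e d y' = 1 → y = y' := by
    intro c d hcd hc hd y y' a1 a2 a3 a4 b1 b2 b3 b4
    by_contra hne
    have hs : ∑ y, (1 + e c y) * (1 + e d y) = 12 := by
      have : ∀ y, (1 + e c y) * (1 + e d y) = 1 + e c y + e d y + e c y * e d y := by
        intro y; ring
      simp only [this, Finset.sum_add_distrib, hcs, hcol c d hcd]
      simp [hY]
    have hle : ∑ z ∈ ({y1, y2, y, y'} : Finset Y), (1 + e c z) * (1 + e d z) ≤ 12 := by
      rw [← hs]
      apply Finset.sum_le_sum_of_subset_of_nonneg (Finset.subset_univ _)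
      intro z _ _
      exact mul_nonneg (by linarith [(hge c z).1]) (by linarith [(hge d z).1])
    rw [Finset.sum_insert (by simp [h12, a1.symm, a3.symm]),
      Finset.sum_insert (by simp [a2.symm, a4.symm]), Finset.sum_pair hne, he1, he1,
      hAe c hc, hAe d hd, b1, b2, b3, b4] at hle
    norm_num at hle
  have hexA : ∀ y, y ≠ y1 → y ≠ y2 → ∃ c ∈ A, ∃ d ∈ A, c ≠ d ∧ e c y = 1 ∧ e d y = 1 := by
    intro y a1 a2
    have h := (hsA y a1 a2).1
    have hs : ∑ x ∈ A, (1 + e x y) = 4 := by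
      rw [Finset.sum_add_distrib, h]; simp [hAc]
    have h2 : ∀ x ∈ A, (1 + e x y) = if e x y = 1 then 2 else 0 := by
      intro x _; rcases he x y with h | h <;> rw [h] <;> norm_num
    rw [Finset.sum_congr rfl h2, ← Finset.sum_filter, Finset.sum_const] at hs
    have hc : (A.filter (fun x => e x y = 1)).card = 2 := by
      simp at hs; omega
    obtain ⟨c, d, hcd, hset⟩ := Finset.card_eq_two.mp hc
    have hc : c ∈ A.filter (fun x => e x y = 1) := by rw [hset]; simp
    have hd : d ∈ A.filter (fun x => e x y = 1) := by rw [hset]; simp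
    rw [Finset.mem_filter] at hc hd
    exact ⟨c, hc.1, d, hd.1, hcd, hc.2, hd.2⟩
  have hfix : ∀ (s : D) (y c d), y ≠ y1 → y ≠ y2 → c ∈ A → d ∈ A → c ≠ d → e c y = 1 → e d y = 1 →
      s • c = c → s • d = d → s • y = y := by
    intro s y c d a1 a2 hc hd hcd b1 b2 sc sd
    apply huniq c d hcd hc hd _ _ _ _ a1 a2 _ _ b1 b2
    · intro h; apply a1; rw [← hy1 s] at h; exact smul_left_cancel s h
    · intro h; apply a2; rw [← hy2 s] at h; exact smul_left_cancel s h
    · rw [← b1, ← hinv s c y, sc]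
    · rw [← b2, ← hinv s d y, sd]
  have hAs : ∀ (s : D) x, x ∈ A → s • x ∈ A := by
    intro s x hx
    rw [hA, Finset.mem_filter]
    refine ⟨Finset.mem_univ _, ?_⟩
    rw [← hAe x hx, ← hinv s x y2, hy2]
  letI act : MulAction D A :=
    { smul := fun s x => ⟨s • (x : X), hAs s x x.2⟩
      one_smul := fun x => Subtype.ext (one_smul D (x : X))
      mul_smul := fun s t x => Subtype.ext (mul_smul s t (x : X)) }
  have hact : ∀ (s : D) (x : A), ((s • x : A) : X) = s • (x : X) := fun _ _ => rfl
  set f := MulAction.toPermHom D A with hf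
  have hfinj : Function.Injective f := by
    rw [injective_iff_map_eq_one]
    intro s hs
    have hs' : ∀ c ∈ A, s • c = c := by
      intro c hc
      have := congrArg (fun p : Equiv.Perm A => ((p ⟨c, hc⟩ : A) : X)) hs
      exact this
    apply hfaith
    intro y
    by_cases a1 : y = y1
    · rw [a1, hy1]
    by_cases a2 : y = y2
    · rw [a2, hy2]
    obtain ⟨c, hc, d, hd, hcd, b1, b2⟩ := hexA y a1 a2
    exact hfix s y c d a1 a2 hc hd hcd b1 b2 (hs' c hc) (hs' d hd)
  have hntop : f.range ≠ ⊤ := by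
    intro htop
    let φ : Fin 5 ≃ A := (Fintype.equivFinOfCardEq (by simp [hAc])).symm
    obtain ⟨s, hs⟩ : ∃ s, f s = Equiv.swap (φ 0) (φ 1) := by
      rw [← MonoidHom.mem_range, htop]; trivial
    have hsc : ∀ i : Fin 5, i ≠ 0 → i ≠ 1 → s • (φ i : X) = φ i := by
      intro i h0 h1
      have := congrArg (fun p : Equiv.Perm A => ((p (φ i) : A) : X)) hs
      rw [Equiv.swap_apply_of_ne_of_ne (by simpa using h0) (by simpa using h1)] at this
      exact this
    have hne : ∀ i j : Fin 5, i ≠ j → (φ i : X) ≠ φ j := by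
      intro i j hij h
      exact hij (φ.injective (Subtype.ext h))
    have hsumA : ∀ h : X → ℤ, ∑ x ∈ A, h x = h (φ 0) + h (φ 1) + h (φ 2) + h (φ 3) + h (φ 4) := by
      intro h
      rw [← Finset.sum_coe_sort, ← φ.sum_comp, Fin.sum_univ_five]
    -- existence of rows
    have hrowex : ∀ i j : Fin 5, i ≠ j → ∃ y, y ≠ y1 ∧ y ≠ y2 ∧ e (φ i) y = 1 ∧ e (φ j) y = 1 := by
      intro i j hij
      by_contra hcon
      push Not at hcon
      have hs : ∑ y, (1 + e (φ i) y) * (1 + e (φ j) y) = 12 := by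
        have : ∀ y, (1 + e (φ i) y) * (1 + e (φ j) y) =
            1 + e (φ i) y + e (φ j) y + e (φ i) y * e (φ j) y := by
          intro y; ring
        simp only [this, Finset.sum_add_distrib, hcs, hcol _ _ (hne i j hij)]
        simp [hY]
      have hs2 : ∑ y ∈ ({y1, y2} : Finset Y), (1 + e (φ i) y) * (1 + e (φ j) y) = 12 := by
        rw [← hs]
        apply Finset.sum_subset (Finset.subset_univ _)
        intro y _ hy
        simp at hy
        rcases he (φ i) y with h | h
        · have := hcon y hy.1 hy.2 h
          rw [(he (φ j) y).resolve_left this]; norm_num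
        · rw [h]; norm_num
      rw [Finset.sum_pair h12, he1, he1, hAe _ (φ i).2, hAe _ (φ j).2] at hs2
      norm_num at hs2
    obtain ⟨r, r1, r2, ra, rb⟩ := hrowex 2 3 (by decide)
    obtain ⟨q, q1, q2, qa, qb⟩ := hrowex 2 4 (by decide)
    obtain ⟨p, p1, p2, pa, pb⟩ := hrowex 3 4 (by decide)
    have er := (hsA r r1 r2).1
    have eq := (hsA q q1 q2).1
    have ep := (hsA p p1 p2).1
    rw [hsumA] at er eq ep
    have g0r := hge (φ 0) r
    have g1r := hge (φ 1) r
    have g4r := hge (φ 4) r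
    have g0q := hge (φ 0) q
    have g1q := hge (φ 1) q
    have g3q := hge (φ 3) q
    have g0p := hge (φ 0) p
    have g1p := hge (φ 1) p
    have g2p := hge (φ 2) p
    have v0r : e (φ 0) r = -1 := by linarith
    have v1r : e (φ 1) r = -1 := by linarith
    have v4r : e (φ 4) r = -1 := by linarith
    have v0q : e (φ 0) q = -1 := by linarith
    have v1q : e (φ 1) q = -1 := by linarith
    have v3q : e (φ 3) q = -1 := by linarith
    have v0p : e (φ 0) p = -1 := by linarith
    have v1p : e (φ 1) p = -1 := by linarith
    have v2p : e (φ 2) p = -1 := by linarith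
    have hrq : r ≠ q := by rintro rfl; rw [qb] at v4r; norm_num at v4r
    have hrp : r ≠ p := by rintro rfl; rw [pb] at v4r; norm_num at v4r
    have hqp : q ≠ p := by rintro rfl; rw [pa] at v3q; norm_num at v3q
    have Brq : ∑ x ∈ B, e x r * e x q = -2 := by
      have := hsplit (fun x => e x r * e x q)
      rw [hrow r q hrq, hsumA, v0r, v1r, ra, rb, v4r, v0q, v1q, qa, qb, v3q] at this
      linarith
    have Brp : ∑ x ∈ B, e x r * e x p = -2 := by
      have := hsplit (fun x => e x r * e x p)
      rw [hrow r p hrp, hsumA, v0r, v1r, ra, rb, v4r, v0p, v1p, pa, pb, v2p] at this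
      linarith
    have Bqp : ∑ x ∈ B, e x q * e x p = -2 := by
      have := hsplit (fun x => e x q * e x p)
      rw [hrow q p hqp, hsumA, v0q, v1q, qa, qb, v3q, v0p, v1p, pa, pb, v2p] at this
      linarith
    have Br := (hsA r r1 r2).2
    have Bq := (hsA q q1 q2).2
    have Bp := (hsA p p1 p2).2
    have hcount : ∀ u v w : ℤ, ∑ x ∈ B, (1 + u * e x r) * (1 + v * e x q) * (1 + w * e x p) =
        6 - 2 * (u * v + u * w + v * w) + u * v * w * ∑ x ∈ B, e x r * e x q * e x p := by
      intro u v w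
      have : ∀ x, (1 + u * e x r) * (1 + v * e x q) * (1 + w * e x p) =
          1 + u * e x r + v * e x q + w * e x p + u * v * (e x r * e x q) + u * w * (e x r * e x p)
          + v * w * (e x q * e x p) + u * v * w * (e x r * e x q * e x p) := by
        intro x; ring
      simp only [this, Finset.sum_add_distrib, ← Finset.mul_sum, Brq, Brp, Bqp, Br, Bq, Bp]
      simp [hBc]; ring
    have hnn : ∀ u v w : ℤ, (u = 1 ∨ u = -1) → (v = 1 ∨ v = -1) → (w = 1 ∨ w = -1) → ∀ x,
        0 ≤ (1 + u * e x r) * (1 + v * e x q) * (1 + w * e x p) := by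
      intro u v w hu hv hw x
      have a : 0 ≤ 1 + u * e x r := by
        rcases hu with rfl | rfl <;> rcases he x r with h | h <;> rw [h] <;> norm_num
      have b : 0 ≤ 1 + v * e x q := by
        rcases hv with rfl | rfl <;> rcases he x q with h | h <;> rw [h] <;> norm_num
      have c : 0 ≤ 1 + w * e x p := by
        rcases hw with rfl | rfl <;> rcases he x p with h | h <;> rw [h] <;> norm_num
      positivity
    have hq0 : ∑ x ∈ B, e x r * e x q * e x p = 0 := by
      have c1 := hcount 1 1 1
      have c2 := hcount (-1) (-1) (-1)
      have n1 := Finset.sum_nonneg (s := B) (fun x _ => hnn 1 1 1 (by simp) (by simp) (by simp) x)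
      have n2 := Finset.sum_nonneg (s := B)
        (fun x _ => hnn (-1) (-1) (-1) (by simp) (by simp) (by simp) x)
      rw [c1] at n1
      rw [c2] at n2
      linarith
    have hinjB : ∀ x ∈ B, ∀ x' ∈ B, e x r = e x' r → e x q = e x' q → e x p = e x' p → x = x' := by
      intro x hx x' hx' h1 h2 h3
      by_contra hxx
      have c1 := hcount (e x r) (e x q) (e x p)
      have hle : ∑ z ∈ ({x, x'} : Finset X),
          (1 + e x r * e z r) * (1 + e x q * e z q) * (1 + e x p * e z p) ≤ 
          ∑ z ∈ B, (1 + e x r * e z r) * (1 + e x q * e z q) * (1 + e x p * e z p) := by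
        apply Finset.sum_le_sum_of_subset_of_nonneg
        · intro z hz
          simp at hz
          rcases hz with rfl | rfl <;> assumption
        · intro z _ _
          exact hnn _ _ _ (he _ _) (he _ _) (he _ _) z
      rw [c1, Finset.sum_pair hxx, ← h1, ← h2, ← h3, hq0, hsq, hsq, hsq] at hle
      rcases he x r with h | h <;> rcases he x q with h' | h' <;> rcases he x p with h'' | h'' <;>
        rw [h, h', h''] at hle <;> norm_num at hle
    have hsr : s • r = r := hfix s r _ _ r1 r2 (φ 2).2 (φ 3).2 (hne 2 3 (by decide)) ra rb
      (hsc 2 (by decide) (by decide)) (hsc 3 (by decide) (by decide))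
    have hsq' : s • q = q := hfix s q _ _ q1 q2 (φ 2).2 (φ 4).2 (hne 2 4 (by decide)) qa qb
      (hsc 2 (by decide) (by decide)) (hsc 4 (by decide) (by decide))
    have hsp : s • p = p := hfix s p _ _ p1 p2 (φ 3).2 (φ 4).2 (hne 3 4 (by decide)) pa pb
      (hsc 3 (by decide) (by decide)) (hsc 4 (by decide) (by decide))
    have hsB : ∀ x ∈ B, s • x = x := by
      intro x hx
      apply hinjB
      · rw [hB, Finset.mem_filter]
        refine ⟨Finset.mem_univ _, ?_⟩
        have := hinv s x y2
        rw [hy2, hBe x hx] at this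
        rw [this]; norm_num
      · exact hx
      · have := hinv s x r; rwa [hsr] at this
      · have := hinv s x q; rwa [hsq'] at this
      · have := hinv s x p; rwa [hsp] at this
    have hfixx : ∀ x y, s • x = x → e x y * e x (s • y) = 1 := by
      intro x y hx
      have := hinv s x y
      rw [hx] at this
      rw [this, hsq]
    have hs1 : s = 1 := by
      apply hfaith
      intro y
      by_contra hy
      have h1 := hrow y (s • y) (Ne.symm hy)
      rw [← hsplit, hsumA, Finset.sum_congr rfl (fun x hx => hfixx x y (hsB x hx)),
        hfixx _ y (hsc 2 (by decide) (by decide)), hfixx _ y (hsc 3 (by decide) (by decide)),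
        hfixx _ y (hsc 4 (by decide) (by decide))] at h1
      simp [hBc] at h1
      have m : ∀ x, -1 ≤ e x y * e x (s • y) := by
        intro x
        rcases he x y with h | h <;> rcases he x (s • y) with h' | h' <;> rw [h, h'] <;> norm_num
      have m0 := m (φ 0)
      have m1 := m (φ 1)
      linarith
    rw [hs1, map_one] at hs
    have := congrArg (fun p : Equiv.Perm A => p (φ 0)) hs
    simp at this
  have hcr : Nat.card f.range = Nat.card D := Nat.card_congr (MonoidHom.ofInjective hfinj).symm.toEquiv
  have hA5 : Fintype.card A = 5 := by simp [hAc]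
  have heq := perm5 hA5 f.range hntop (hcr ▸ h3) (hcr ▸ h5)
  have hiso : D ≃* alternatingGroup A := (MonoidHom.ofInjective hfinj).trans (MulEquiv.subgroupCongr heq)
  haveI : IsSimpleGroup (alternatingGroup A) := alternatingGroup.isSimpleGroup (by
    rw [Nat.card_eq_fintype_card, hA5])
  haveI : Nontrivial A := Fintype.one_lt_card_iff_nontrivial.mp (by omega)
  refine ⟨?_, MulEquiv.isSimpleGroup hiso⟩
  rw [Nat.card_congr hiso.toEquiv, nat_card_alternatingGroup, Nat.card_eq_fintype_card, hA5]
  rfl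

lemma orb_stab (H : Type*) {Y : Type*} [Group H] [MulAction H Y] (y : Y) :
    Nat.card (MulAction.orbit H y) * Nat.card (MulAction.stabilizer H y) = Nat.card H := by
  rw [← Nat.card_prod]
  exact Nat.card_congr (MulAction.orbitProdStabilizerEquivGroup H y)

lemma card_two_trans {H Y : Type*} [Group H] [Finite H] [MulAction H Y] [Fintype Y] [DecidableEq Y]
    (hY : Fintype.card Y = 12) (a b : Y) (hab : a ≠ b)
    (h2 : ∀ c d : Y, c ≠ d → ∃ s : H, s • a = c ∧ s • b = d) :
    Nat.card H = 132 * Nat.card (MulAction.stabilizer H ((a, b) : Y × Y)) := by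
  classical
  have horb : MulAction.orbit H ((a, b) : Y × Y) = ((Finset.univ : Finset Y).offDiag : Set (Y × Y)) := by
    ext ⟨c, d⟩
    simp only [MulAction.mem_orbit_iff, Prod.smul_mk, Prod.mk.injEq, Finset.mem_coe,
      Finset.mem_offDiag, Finset.mem_univ, true_and]
    constructor
    · rintro ⟨s, rfl, rfl⟩ h
      exact hab (smul_left_cancel s h)
    · exact h2 c d
  have hcard : Nat.card (MulAction.orbit H ((a, b) : Y × Y)) = 132 := by
    rw [horb, Nat.card_coe_set_eq, Set.ncard_coe_finset, Finset.offDiag_card, Finset.card_univ, hY]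
  rw [← hcard, orb_stab]

lemma lemG {G X Y : Type*} [Group G] [Finite G] [MulAction G X] [MulAction G Y]
    [Fintype X] [Fintype Y] [DecidableEq X] [DecidableEq Y]
    (hX : Fintype.card X = 11) (hY : Fintype.card Y = 12)
    (e : X → Y → ℤ) (he : ∀ x y, e x y = 1 ∨ e x y = -1)
    (hcs : ∀ x, ∑ y, e x y = 0)
    (hinv : ∀ (s : G) x y y', e (s • x) (s • y) * e (s • x) (s • y') = e x y * e x y')
    (hfaith : ∀ s : G, (∀ x : X, s • x = x) → (∀ y : Y, s • y = y) → s = 1)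
    (h2 : ∀ a b c d : Y, a ≠ b → c ≠ d → ∃ s : G, s • a = c ∧ s • b = d)
    (h3 : ∃ (s : G) (a b : Y), a ≠ b ∧ s • a = a ∧ s • b = b ∧ 3 ∣ orderOf s)
    (h5 : ∃ (s : G) (a b : Y), a ≠ b ∧ s • a = a ∧ s • b = b ∧ 5 ∣ orderOf s) :
    Nat.card G = 7920 ∧ IsSimpleGroup G ∧ ∀ s : G, (∀ x : X, s • x = x) → s = 1 := by
  classical
  have hsq : ∀ x y, e x y * e x y = 1 := by
    intro x y; rcases he x y with h | h <;> rw [h] <;> norm_num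
  obtain ⟨y1, y2, h12⟩ := Fintype.exists_pair_of_one_lt_card (α := Y) (by omega)
  -- rows
  have hM : ∀ (s : G) y y', ∑ x, e x (s • y) * e x (s • y') = ∑ x, e x y * e x y' := by
    intro s y y'
    rw [← Equiv.sum_comp (MulAction.toPerm s : Equiv.Perm X)]
    apply Finset.sum_congr rfl
    intro x _
    exact hinv s x y y'
  have hMc : ∀ y y', y ≠ y' → ∑ x, e x y * e x y' = ∑ x, e x y1 * e x y2 := by
    intro y y' h
    obtain ⟨s, rfl, rfl⟩ := h2 y1 y2 y y' h12 h
    exact hM s y1 y2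
  have hMd : ∀ y, ∑ x, e x y * e x y = 11 := by
    intro y; simp [hsq, hX]
  have hm : ∑ x, e x y1 * e x y2 = -1 := by
    set m := ∑ x, e x y1 * e x y2 with hmdef
    have h0 : ∑ y, ∑ y', ∑ x, e x y * e x y' = 0 := by
      have : ∀ y, ∑ y', ∑ x, e x y * e x y' = 0 := by
        intro y
        rw [Finset.sum_comm]
        simp [← Finset.mul_sum, hcs]
      simp [this]
    have h1 : ∀ y, ∑ y', ∑ x, e x y * e x y' = 11 + 11 * m := by
      intro y
      rw [← Finset.add_sum_erase _ _ (Finset.mem_univ y), hMd,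
        Finset.sum_congr rfl (fun y' hy' => hMc y y' (Finset.ne_of_mem_erase hy').symm),
        Finset.sum_const, Finset.card_erase_of_mem (Finset.mem_univ y), Finset.card_univ, hY]
      norm_num
    simp only [h1, Finset.sum_const, Finset.card_univ, hY] at h0
    norm_num at h0
    linarith
  have hrow : ∀ y y', y ≠ y' → ∑ x, e x y * e x y' = -1 := fun y y' h => (hMc y y' h).trans hm
  -- columns
  have hcol : ∀ x x', x ≠ x' → ∑ y, e x y * e x' y = 0 := by
    let A : Matrix Y (Option X) ℚ := fun y o => o.elim 1 (fun x => (e x y : ℚ))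
    let B : Matrix (Option X) Y ℚ := fun o y => (1 / 12) * A y o
    have hAB : A * B = 1 := by
      ext y y'
      rw [Matrix.mul_apply, Fintype.sum_option]
      simp only [A, B, Option.elim_none, Option.elim_some]
      have : ∑ x, (e x y : ℚ) * (1 / 12 * (e x y' : ℚ)) = (1 / 12) * ((∑ x, e x y * e x y' : ℤ) : ℚ) := by
        push_cast; rw [Finset.mul_sum]; apply Finset.sum_congr rfl; intros; ring
      rw [this]
      by_cases h : y = y'
      · subst h; rw [hMd, Matrix.one_apply_eq]; norm_num
      · rw [hrow y y' h, Matrix.one_apply_ne h]; norm_num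
    have hcc : Fintype.card Y = Fintype.card (Option X) := by simp [hX, hY]
    have hBA : B * A = 1 :=
      (Matrix.mul_eq_one_comm_of_equiv (Fintype.equivOfCardEq hcc)).mp hAB
    intro x x' hx
    have := congrFun (congrFun hBA (some x)) (some x')
    rw [Matrix.mul_apply, Matrix.one_apply_ne (by simpa using hx)] at this
    simp only [A, B, Option.elim_some] at this
    have h' : (1 / 12 : ℚ) * ((∑ y, e x y * e x' y : ℤ) : ℚ) = 0 := by
      rw [← this]; push_cast; rw [Finset.mul_sum]; apply Finset.sum_congr rfl; intros; ring
    have h'' : ((∑ y, e x y * e x' y : ℤ) : ℚ) = 0 := by linarith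
    exact_mod_cast h''
  -- rows are distinct
  have hrowinj : ∀ y y', (∀ x, e x y = e x y') → y = y' := by
    intro y y' h
    by_contra hne
    have := hrow y y' hne
    simp only [← h] at this
    rw [hMd] at this
    norm_num at this
  -- faithful on Y
  have hfY : ∀ s : G, (∀ y : Y, s • y = y) → s = 1 := by
    intro s hs
    refine hfaith s (fun x => ?_) hs
    by_contra hx
    have h0 := hcol (s • x) x hx
    have hcon : ∀ y, e (s • x) y * e x y = e (s • x) y1 * e x y1 := by
      intro y
      have h := hinv s x y y1
      rw [hs, hs] at h
      calc e (s • x) y * e x y = e (s • x) y * e x y * (e (s • x) y1 * e (s • x) y1) := by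
              rw [hsq, mul_one]
        _ = (e (s • x) y * e (s • x) y1) * e x y * e (s • x) y1 := by ring
        _ = (e x y * e x y) * (e (s • x) y1 * e x y1) := by rw [h]; ring
        _ = _ := by rw [hsq, one_mul]
    rw [Finset.sum_congr rfl (fun y _ => hcon y), Finset.sum_const, Finset.card_univ, hY] at h0
    rcases he (s • x) y1 with h | h <;> rcases he x y1 with h' | h' <;> rw [h, h'] at h0 <;>
      norm_num at h0
  have hcardG := fun a b (hab : a ≠ b) => card_two_trans (H := G) hY a b hab (fun c d => h2 a b c d hab)
  have hsub : ∀ n : ℕ, (∃ (s : G) (a b : Y), a ≠ b ∧ s • a = a ∧ s • b = b ∧ n ∣ orderOf s) →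
      n ∣ Nat.card (MulAction.stabilizer G ((y1, y2) : Y × Y)) := by
    rintro n ⟨s, a, b, hab, ha, hb, hn⟩
    have h1 := hcardG a b hab
    rw [hcardG y1 y2 h12] at h1
    have h1' := Nat.eq_of_mul_eq_mul_left (by norm_num) h1
    rw [h1']
    refine hn.trans ?_
    have hmem : s ∈ MulAction.stabilizer G ((a, b) : Y × Y) := by
      rw [MulAction.mem_stabilizer_iff, Prod.smul_mk, ha, hb]
    have := orderOf_dvd_natCard (⟨s, hmem⟩ : MulAction.stabilizer G ((a, b) : Y × Y))
    rwa [Subgroup.orderOf_mk] at this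
  set D := MulAction.stabilizer G ((y1, y2) : Y × Y) with hD
  have hDm : ∀ s : G, s ∈ D ↔ s • y1 = y1 ∧ s • y2 = y2 := by
    intro s
    rw [hD, MulAction.mem_stabilizer_iff, Prod.smul_mk, Prod.mk.injEq]
  obtain ⟨hD60, hDs⟩ : Nat.card D = 60 ∧ IsSimpleGroup D := by
    refine lemD (D := D) hX hY (fun x y => e x y1 * e x y) ?_ y1 y2 h12 (fun x => hsq x y1) ?_ ?_ ?_ ?_ ?_
      ?_ ?_ (hsub 3 h3) (hsub 5 h5)
    · intro x y
      rcases he x y1 with h | h <;> rcases he x y with h' | h' <;> simp [h, h']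
    · intro y y' hy
      rw [← hrow y y' hy]
      apply Finset.sum_congr rfl
      intro x _
      linear_combination (e x y * e x y') * hsq x y1
    · intro x
      simp only [← Finset.mul_sum, hcs, mul_zero]
    · intro x x' hx
      have := hcol x x' hx
      have h : ∀ y, e x y1 * e x y * (e x' y1 * e x' y) = (e x y1 * e x' y1) * (e x y * e x' y) := by
        intro y; ring
      simp only [h, ← Finset.mul_sum, this, mul_zero]
    · rintro ⟨s, hs⟩ x y
      have := hinv s x y1 y
      rw [((hDm s).mp hs).1] at this
      exact this
    · rintro ⟨s, hs⟩ h
      exact Subtype.ext (hfY s h)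
    · rintro ⟨s, hs⟩; exact ((hDm s).mp hs).1
    · rintro ⟨s, hs⟩; exact ((hDm s).mp hs).2
  have hG : Nat.card G = 7920 := by
    rw [hcardG y1 y2 h12, hD60]
  -- normal subgroups are transitive on Y
  have hntr : ∀ N : Subgroup G, N.Normal → N ≠ ⊥ → ∀ c d : Y, ∃ n ∈ N, n • c = d := by
    intro N hN hne c d
    by_cases hcd : c = d
    · exact ⟨1, N.one_mem, by rw [one_smul, hcd]⟩
    obtain ⟨n, hn1⟩ := Subgroup.ne_bot_iff_exists_ne_one.mp hne
    have hn := n.2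
    obtain ⟨y, hy⟩ : ∃ y : Y, (n : G) • y ≠ y := by
      by_contra hcon
      push Not at hcon
      exact hn1 (Subtype.ext (hfY n hcon))
    obtain ⟨s, hs1, hs2⟩ := h2 y ((n : G) • y) c d (Ne.symm hy) hcd
    refine ⟨s * n * s⁻¹, hN.conj_mem _ hn s, ?_⟩
    rw [mul_smul, mul_smul, ← hs1, inv_smul_smul, hs2]
  have hn12 : ∀ N : Subgroup G, N.Normal → N ≠ ⊥ →
      12 * Nat.card (MulAction.stabilizer N y1) = Nat.card N := by
    intro N hN hne
    have horb : MulAction.orbit N y1 = Set.univ := by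
      ext d
      simp only [Set.mem_univ, iff_true]
      obtain ⟨n, hn, h⟩ := hntr N hN hne y1 d
      exact ⟨⟨n, hn⟩, h⟩
    rw [← orb_stab N y1, horb, Nat.card_coe_set_eq,
      Set.ncard_univ, Nat.card_eq_fintype_card (α := Y), hY]
  haveI : Fact (Nat.Prime 3) := ⟨by norm_num⟩
  haveI : Fact (Nat.Prime 2) := ⟨by norm_num⟩
  haveI : Fact (Nat.Prime 11) := ⟨by norm_num⟩
  refine ⟨hG, ?_, ?_⟩
  · -- simplicity
    have hone : ∀ N : Subgroup G, N.Normal → N ≠ ⊥ → N = ⊤ := by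
      intro N hN hne
      let S := MulAction.stabilizer G y1
      let Z := SubMulAction.ofStabilizer G y1
      have hZt : MulAction.IsPretransitive S Z := by
        refine ⟨fun c d => ?_⟩
        obtain ⟨s, hs1, hs2⟩ := h2 y1 c y1 d (SubMulAction.neq_of_mem_ofStabilizer G y1).symm
          (SubMulAction.neq_of_mem_ofStabilizer G y1).symm
        exact ⟨⟨s, hs1⟩, Subtype.ext hs2⟩
      have hZc : Nat.card Z = 11 := by
        have h1 : Nat.card Z = ({y1}ᶜ : Set Y).ncard := by
          rw [← Nat.card_coe_set_eq]
          rfl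
        rw [h1, Set.ncard_compl, Nat.card_eq_fintype_card, hY, Set.ncard_singleton]
      have hZp : MulAction.IsPreprimitive S Z :=
        MulAction.IsPreprimitive.of_prime_card (by rw [hZc]; norm_num)
      by_cases hfp : MulAction.fixedPoints (N.subgroupOf S) Z = Set.univ
      · exfalso
        have hall : ∀ n ∈ N, n • y1 = y1 → n = 1 := by
          intro n hn h1
          apply hfY
          intro y
          by_cases hy : y = y1
          · rw [hy, h1]
          have hmem : (⟨y, hy⟩ : Z) ∈ MulAction.fixedPoints (N.subgroupOf S) Z := by rw [hfp]; trivial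
          have := hmem ⟨⟨n, h1⟩, hn⟩
          exact congrArg Subtype.val this
        have hst : MulAction.stabilizer N y1 = ⊥ := by
          rw [eq_bot_iff]
          rintro ⟨n, hn⟩ h
          exact Subtype.ext (hall n hn h)
        have hcN := hn12 N hN hne
        rw [hst, Subgroup.card_bot] at hcN
        obtain ⟨u, hu⟩ := exists_prime_orderOf_dvd_card' (G := N) 2 (by rw [← hcN]; norm_num)
        obtain ⟨v, hv⟩ := exists_prime_orderOf_dvd_card' (G := N) 3 (by rw [← hcN]; norm_num)
        have hu1 : (u : G) • y1 ≠ y1 := by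
          intro h
          have : u = 1 := Subtype.ext (hall u u.2 h)
          rw [this, orderOf_one] at hu
          norm_num at hu
        have hv1 : (v : G) • y1 ≠ y1 := by
          intro h
          have : v = 1 := Subtype.ext (hall v v.2 h)
          rw [this, orderOf_one] at hv
          norm_num at hv
        obtain ⟨s, hs1, hs2⟩ := h2 y1 _ y1 _ hu1.symm hv1.symm
        have hs1' : s⁻¹ • y1 = y1 := by rw [inv_smul_eq_iff, hs1]
        have h1 := hall ((v : G)⁻¹ * (s * u * s⁻¹)) (N.mul_mem (N.inv_mem v.2) (hN.conj_mem _ u.2 s))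
          (by rw [mul_smul, mul_smul, mul_smul, hs1', hs2, inv_smul_smul])
        have h4 : (v : G) = s * u * s⁻¹ := by
          rw [inv_mul_eq_one] at h1; exact h1
        have h6 : orderOf (v : G) = orderOf (u : G) := by
          rw [h4]
          exact (MulAut.conj s).orderOf_eq (u : G)
        rw [Subgroup.orderOf_coe, Subgroup.orderOf_coe, hu, hv] at h6
        norm_num at h6
      · have hZN : MulAction.IsPretransitive (N.subgroupOf S) Z :=
          MulAction.IsQuasiPreprimitive.isPretransitive_of_normal hfp
        have hN1 : ∀ c d, c ≠ y1 → d ≠ y1 → ∃ n ∈ N, n • y1 = y1 ∧ n • c = d := by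
          intro c d hc hd
          obtain ⟨⟨⟨n, hn1⟩, hn⟩, h⟩ := hZN.exists_smul_eq (⟨c, hc⟩ : Z) (⟨d, hd⟩ : Z)
          exact ⟨n, hn, hn1, congrArg Subtype.val h⟩
        have hN2 : ∀ c d : Y, c ≠ d → ∃ n ∈ N, n • y1 = c ∧ n • y2 = d := by
          intro c d hcd
          obtain ⟨n1, hn1, hc⟩ := hntr N hN hne y1 c
          obtain ⟨n2, hn2, h21, h22⟩ := hN1 y2 (n1⁻¹ • d) h12.symm (by
            intro h
            rw [inv_smul_eq_iff, hc] at h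
            exact hcd h.symm)
          exact ⟨n1 * n2, N.mul_mem hn1 hn2, by rw [mul_smul, h21, hc],
            by rw [mul_smul, h22, smul_inv_smul]⟩
        rcases (inferInstance : (N.subgroupOf D).Normal).eq_bot_or_eq_top with hb | ht
        · exfalso
          have hDN : ∀ n ∈ N, n • y1 = y1 → n • y2 = y2 → n = 1 := by
            intro n hn h1 h2
            have : (⟨n, (hDm n).mpr ⟨h1, h2⟩⟩ : D) ∈ N.subgroupOf D := hn
            rw [hb, Subgroup.mem_bot] at this
            exact congrArg Subtype.val this
          have hcN := card_two_trans (H := N) hY y1 y2 h12 (fun c d hcd => by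
            obtain ⟨n, hn, h⟩ := hN2 c d hcd
            exact ⟨⟨n, hn⟩, h⟩)
          have hst : MulAction.stabilizer N ((y1, y2) : Y × Y) = ⊥ := by
            rw [eq_bot_iff]
            rintro ⟨n, hn⟩ h
            rw [MulAction.mem_stabilizer_iff, Prod.smul_mk, Prod.mk.injEq] at h
            exact Subtype.ext (hDN n hn h.1 h.2)
          rw [hst, Subgroup.card_bot] at hcN
          have hcP := hn12 N hN hne
          rw [hcN] at hcP
          have hP : Nat.card (MulAction.stabilizer N y1) = 11 := by omega
          obtain ⟨a, ha⟩ := exists_prime_orderOf_dvd_card' (G := D) 3 (by rw [hD60]; norm_num)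
          obtain ⟨ha1, ha2⟩ := (hDm (a : G)).mp a.2
          have hane : a ≠ 1 := by
            rintro rfl
            rw [orderOf_one] at ha
            norm_num at ha
          have hpg : IsPGroup 3 (Subgroup.zpowers (a : G)) := by
            apply IsPGroup.of_card (n := 1)
            rw [Nat.card_zpowers, Subgroup.orderOf_coe, ha, pow_one]
          have hmod := hpg.card_modEq_card_fixedPoints Y
          rw [Nat.card_eq_fintype_card, hY] at hmod
          have hfa : ∀ y, y ∈ MulAction.fixedPoints (Subgroup.zpowers (a : G)) Y ↔ (a : G) • y = y := by
            intro y
            constructor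
            · intro h
              exact h ⟨a, Subgroup.mem_zpowers _⟩
            · rintro h ⟨b, hb⟩
              obtain ⟨k, rfl⟩ := Subgroup.mem_zpowers_iff.mp hb
              have : (a : G) ^ k ∈ MulAction.stabilizer G y := Subgroup.zpow_mem _ h k
              exact this
          obtain ⟨y3, h31, h32, h33⟩ : ∃ y3, y3 ≠ y1 ∧ y3 ≠ y2 ∧ (a : G) • y3 = y3 := by
            by_contra hcon
            push Not at hcon
            have : MulAction.fixedPoints (Subgroup.zpowers (a : G)) Y = {y1, y2} := by
              ext y
              rw [hfa]
              constructor
              · intro h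
                by_contra hy
                simp at hy
                exact hcon y hy.1 hy.2 h
              · rintro (rfl | rfl)
                · exact ha1
                · exact ha2
            rw [this, Nat.card_coe_set_eq, Set.ncard_pair h12] at hmod
            exact absurd hmod (by decide)
          obtain ⟨n, hn, hn1, hn2⟩ := hN1 y2 y3 h12.symm h31
          have hcom0 := hDN (n⁻¹ * (a * n * (a : G)⁻¹))
            (N.mul_mem (N.inv_mem hn) (hN.conj_mem _ hn a))
            (by rw [mul_smul, mul_smul, mul_smul, inv_smul_eq_iff.mpr ha1.symm, hn1, ha1,
                  inv_smul_eq_iff.mpr hn1.symm])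
            (by rw [mul_smul, mul_smul, mul_smul, inv_smul_eq_iff.mpr ha2.symm, hn2, h33,
                  inv_smul_eq_iff.mpr hn2.symm])
          have hcom : Commute (a : G) n := by
            rw [inv_mul_eq_one, eq_mul_inv_iff_mul_eq] at hcom0
            exact hcom0.symm
          have hnP : (⟨⟨n, hn⟩, hn1⟩ : MulAction.stabilizer N y1) ≠ 1 := by
            intro h
            have : n = 1 := congrArg (fun z : MulAction.stabilizer N y1 => ((z : N) : G)) h
            rw [this, one_smul] at hn2
            exact h32 hn2.symm
          apply hane
          apply Subtype.ext
          apply hfY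
          intro d
          by_cases hd : d = y1
          · rw [hd, ha1]
          obtain ⟨m, hm, hm1, hm2⟩ := hN1 y2 d h12.symm hd
          obtain ⟨k, hk⟩ := Subgroup.mem_zpowers_iff.mp
            (mem_zpowers_of_prime_card hP hnP (g' := (⟨⟨m, hm⟩, hm1⟩ : MulAction.stabilizer N y1)))
          have hk' : n ^ k = m := congrArg (fun z : MulAction.stabilizer N y1 => ((z : N) : G)) hk
          rw [← hm2, ← mul_smul, ← hk', (hcom.zpow_right k).eq, mul_smul, ha2]
        · rw [eq_top_iff]
          intro s _
          obtain ⟨n, hn, ha, hb⟩ := hN2 (s • y1) (s • y2) (fun h => h12 (smul_left_cancel s h))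
          have hmem : n⁻¹ * s ∈ D := by
            rw [hDm, mul_smul, mul_smul]
            exact ⟨inv_smul_eq_iff.mpr ha.symm, inv_smul_eq_iff.mpr hb.symm⟩
          have : (⟨n⁻¹ * s, hmem⟩ : D) ∈ N.subgroupOf D := by rw [ht]; trivial
          have h' : n⁻¹ * s ∈ N := this
          have := N.mul_mem hn h'
          rwa [mul_inv_cancel_left] at this
    haveI : Nontrivial G := by
      rw [← Finite.one_lt_card_iff_nontrivial, hG]; norm_num
    exact ⟨fun N hN => or_iff_not_imp_left.mpr (hone N hN)⟩
  · -- kernel on X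
    have hker : MonoidHom.ker (MulAction.toPermHom G X) = ⊥ := by
      by_contra hne
      have hc := hn12 _ inferInstance hne
      obtain ⟨v, hv⟩ := exists_prime_orderOf_dvd_card' (G := MonoidHom.ker (MulAction.toPermHom G X)) 3
        (by rw [← hc]; exact Dvd.dvd.mul_right (by norm_num) _)
      have hvx : ∀ x : X, (v : G) • x = x := by
        intro x
        have := v.2
        rw [MonoidHom.mem_ker] at this
        exact congrArg (fun p : Equiv.Perm X => p x) this
      have hv3 : (v : G) ^ 3 = 1 := by
        have := pow_orderOf_eq_one v
        rw [hv] at this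
        exact_mod_cast this
      have hvy : ∀ y : Y, (v : G) • y = y := by
        intro y
        refine (hrowinj _ _ (fun x => ?_))
        have i1 := hinv v x y ((v : G) • y)
        have i2 := hinv v x y ((v : G) • (v : G) • y)
        have h3 : (v : G) • (v : G) • (v : G) • y = y := by
          rw [← mul_smul, ← mul_smul, ← pow_two, ← pow_succ, hv3, one_smul]
        rw [hvx] at i1 i2
        rw [h3] at i2
        rcases he x y with a | a <;> rcases he x ((v : G) • y) with b | b <;>
          rcases he x ((v : G) • (v : G) • y) with c | c <;> rw [a, b, c] at i1 <;> rw [a, b, c] at i2 <;>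
          rw [a, b] <;> first | (exfalso; norm_num at i1; done) | (exfalso; norm_num at i2; done)
      have : v = 1 := Subtype.ext (hfY v hvy)
      rw [this, orderOf_one] at hv
      norm_num at hv
    intro s hs
    have : s ∈ MonoidHom.ker (MulAction.toPermHom G X) := by
      rw [MonoidHom.mem_ker]
      ext x
      exact hs x
    rwa [hker, Subgroup.mem_bot] at this

set_option linter.style.haveILetI false
attribute [local instance] Ideal.Quotient.field in
lemma frob_aux (R K L : Type) [CommRing R] [IsDomain R] [Field K] [Field L]
    [Algebra R K] [IsFractionRing R K] [Algebra K L] [Algebra R L] [IsScalarTower R K L]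
    [IsIntegrallyClosed R] [FiniteDimensional K L] [IsGalois K L]
    (p : ℕ) [Fact p.Prime] (P : Ideal R) [P.IsMaximal] (hP : Nat.card (R ⧸ P) = p) :
    ∃ (k : Type) (_ : Field k) (_ : CharP k p) (ψ : R →+* k) (σ : L ≃ₐ[K] L)
      (π : integralClosure R L →+* k),
      (∀ r ∈ P, ψ r = 0) ∧ (∀ r, π (algebraMap R (integralClosure R L) r) = ψ r) ∧
      ∀ b b' : integralClosure R L, (b' : L) = σ b → π b' = π b ^ p := by
  set B := integralClosure R L with hB
  haveI hfrac : IsFractionRing B L := integralClosure.isFractionRing_of_finite_extension K L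
  letI act := IsIntegralClosure.MulSemiringAction R K L B
  haveI hinv : Algebra.IsInvariant R B (L ≃ₐ[K] L) := Algebra.isInvariant_of_isGalois R K L B
  haveI hcomm : SMulCommClass (L ≃ₐ[K] L) R B := ⟨fun s r b => by
    exact map_smul (galRestrict R K L B s) r b⟩
  haveI : FaithfulSMul R B := by
    rw [faithfulSMul_iff_algebraMap_injective]
    intro a b hab
    have := congrArg (algebraMap B L) hab
    rw [← IsScalarTower.algebraMap_apply, ← IsScalarTower.algebraMap_apply,
      IsScalarTower.algebraMap_apply R K L, IsScalarTower.algebraMap_apply R K L] at this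
    exact IsFractionRing.injective R K ((algebraMap K L).injective this)
  haveI : Algebra.IsIntegral R B := inferInstance
  obtain ⟨Q, hQm, hQ⟩ := Ideal.exists_maximal_ideal_liesOver_of_isIntegral (S := B) P
  haveI hfinP : Finite (R ⧸ P) := Nat.finite_of_card_ne_zero (by
    rw [hP]; exact (Fact.out : p.Prime).ne_zero)
  haveI : Algebra.IsIntegral (R ⧸ P) (B ⧸ Q) := inferInstance
  haveI : Module.Finite (R ⧸ P) (B ⧸ Q) := Ideal.Quotient.finite_of_isInvariant (L ≃ₐ[K] L) P Q
  haveI : Finite (B ⧸ Q) := Module.finite_of_finite (R ⧸ P)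
  obtain ⟨σ, hσ⟩ := IsArithFrobAt.exists_of_isInvariant R (L ≃ₐ[K] L) Q
  have hund : Q.under R = P := hQ.over.symm
  refine ⟨B ⧸ Q, inferInstance, ?_, (Ideal.Quotient.mk Q).comp (algebraMap R B), σ,
    Ideal.Quotient.mk Q, ?_, fun _ => rfl, ?_⟩
  · have h0 : (p : R ⧸ P) = 0 := by
      rw [← hP]
      have := card_nsmul_eq_zero' (x := (1 : R ⧸ P))
      rwa [nsmul_eq_mul, mul_one] at this
    have h1 : (p : B ⧸ Q) = 0 := by
      have := congrArg (algebraMap (R ⧸ P) (B ⧸ Q)) h0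
      simpa using this
    exact (CharP.charP_iff_prime_eq_zero Fact.out).mpr h1
  · intro r hr
    rw [← hund] at hr
    exact Ideal.Quotient.eq_zero_iff_mem.mpr hr
  · intro b b' hb
    have h := hσ b
    rw [hund, hP] at h
    rw [← map_pow]
    apply Ideal.Quotient.eq.mpr
    convert h using 2
    apply Subtype.ext
    rw [hb]
    exact (algebraMap_galRestrictHom_apply R K L B σ b).symm

open Polynomial in
lemma frob_poly (R K L : Type) [CommRing R] [IsDomain R] [Field K] [Field L]
    [Algebra R K] [IsFractionRing R K] [Algebra K L] [Algebra R L] [IsScalarTower R K L]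
    [IsIntegrallyClosed R] [FiniteDimensional K L] [IsGalois K L]
    (p : ℕ) [Fact p.Prime] (P : Ideal R) [P.IsMaximal] (hP : Nat.card (R ⧸ P) = p)
    (f : R[X]) (hf : f.Monic) (hs : (f.map (algebraMap R L)).Splits) :
    ∃ (k : Type) (_ : Field k) (_ : CharP k p) (ψ : R →+* k) (σ : L ≃ₐ[K] L)
      (ε : L → k), (∀ r ∈ P, ψ r = 0) ∧
      f.map ψ = (((f.map (algebraMap R L)).roots.map ε).map (fun a => X - C a)).prod ∧
      ∀ y, (f.map (algebraMap R L)).IsRoot y → ε (σ y) = ε y ^ p := by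
  classical
  obtain ⟨k, hk, hc, ψ, σ, π, h1, h2, h3⟩ := frob_aux R K L p P hP
  have hint : ∀ y, (f.map (algebraMap R L)).IsRoot y → IsIntegral R y := by
    intro y hy
    refine ⟨f, hf, ?_⟩
    rw [IsRoot, eval_map] at hy
    exact hy
  refine ⟨k, hk, hc, ψ, σ, fun y => if h : IsIntegral R y then π ⟨y, h⟩ else 0, h1, ?_, ?_⟩
  · have hm : ∀ y ∈ (f.map (algebraMap R L)).roots, y ∈ integralClosure R L := by
      intro y hy
      exact hint y (isRoot_of_mem_roots hy)
    have hprod := hs.eq_prod_roots_of_monic (hf.map _)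
    generalize (f.map (algebraMap R L)).roots = m at hm hprod
    lift m to Multiset (integralClosure R L) using hm
    have e1 : f.map (algebraMap R (integralClosure R L)) = (m.map (fun a => X - C a)).prod := by
      apply map_injective (algebraMap (integralClosure R L) L) Subtype.val_injective
      rw [Polynomial.map_map, ← IsScalarTower.algebraMap_eq, hprod, Polynomial.map_multiset_prod,
        Multiset.map_map, Multiset.map_map]
      congr 1
      apply Multiset.map_congr rfl
      intro a _
      simp
    have e2 := congrArg (fun q => q.map π) e1
    simp only [Polynomial.map_map, Polynomial.map_multiset_prod, Multiset.map_map] at e2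
    have e3 : π.comp (algebraMap R (integralClosure R L)) = ψ := RingHom.ext h2
    rw [e3] at e2
    rw [e2, Multiset.map_map, Multiset.map_map]
    congr 1
    apply Multiset.map_congr rfl
    intro a _
    have ha : IsIntegral R (a : L) := a.2
    simp [ha]
  · intro y hy
    have hy1 := hint y hy
    have hy2 : IsIntegral R (σ y) := hy1.map ((σ : L →ₐ[K] L).restrictScalars R)
    simp only [hy1, hy2, dif_pos]
    exact h3 ⟨y, hy1⟩ ⟨σ y, hy2⟩ rfl

open Polynomial in
lemma frob_int (K L : Type) [Field K] [CharZero K] [Field L] [Algebra K L] [FiniteDimensional K L] [IsGalois K L]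
    (τ : K) (hinj : Function.Injective (eval₂RingHom (Int.castRingHom K) τ))
    (hsurj : ∀ z : K, ∃ a b : ℤ[X], z = eval₂ (Int.castRingHom K) τ a / eval₂ (Int.castRingHom K) τ b)
    (p : ℕ) [Fact p.Prime] (r0 : ℤ)
    (f : ℤ[X][X]) (hf : f.Monic)
    (hs : (f.map (eval₂RingHom (Int.castRingHom L) (algebraMap K L τ))).Splits) :
    ∃ (k : Type) (_ : Field k) (_ : CharP k p) (σ : L ≃ₐ[K] L) (ε : L → k),
      f.map (eval₂RingHom (Int.castRingHom k) (r0 : k)) =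
        (((f.map (eval₂RingHom (Int.castRingHom L) (algebraMap K L τ))).roots.map ε).map
          (fun a => X - C a)).prod ∧
      ∀ y, (f.map (eval₂RingHom (Int.castRingHom L) (algebraMap K L τ))).IsRoot y →
        ε (σ y) = ε y ^ p := by
  suffices H : ∀ (R : Type) [CommRing R] [IsDomain R] [IsIntegrallyClosed R] (i : R →+* K)
      (j : R →+* L) (_ : j = (algebraMap K L).comp i) (_ : Function.Injective i)
      (_ : ∀ z, ∃ a b : R, z = i a / i b) (φ : R →+* ZMod p) (_ : Function.Surjective φ) (f : R[X])
      (_ : f.Monic) (_ : (f.map j).Splits), 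
      ∃ (k : Type) (_ : Field k) (_ : CharP k p) (ψ : R →+* k) (σ : L ≃ₐ[K] L) (ε : L → k),
      (∀ r, φ r = 0 → ψ r = 0) ∧
      f.map ψ = (((f.map j).roots.map ε).map (fun a => X - C a)).prod ∧
      ∀ y, (f.map j).IsRoot y → ε (σ y) = ε y ^ p by
    obtain ⟨k, hk, hc, ψ, σ, ε, h1, h2, h3⟩ := H ℤ[X] (eval₂RingHom (Int.castRingHom K) τ)
      (eval₂RingHom (Int.castRingHom L) (algebraMap K L τ)) (by
        apply ringHom_ext
        · intro a; simp
        · simp) hinj hsurj (eval₂RingHom (Int.castRingHom (ZMod p)) (r0 : ZMod p))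
      (fun z => ⟨C (z.cast : ℤ), by simp⟩) f hf hs
    refine ⟨k, hk, hc, σ, ε, ?_, h3⟩
    rw [← h2]
    congr 1
    apply ringHom_ext
    · intro a; simp
    · have := h1 (X - C r0) (by simp)
      rw [map_sub, sub_eq_zero] at this
      rw [this]
      simp
  intro R _ _ _ i j hj hi hsu φ hφ f hf hs
  letI : Algebra R K := i.toAlgebra
  letI : Algebra R L := j.toAlgebra
  haveI : IsScalarTower R K L := IsScalarTower.of_algebraMap_eq' hj
  haveI : FaithfulSMul R K := (faithfulSMul_iff_algebraMap_injective R K).mpr hi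
  haveI : IsFractionRing R K := IsFractionRing.of_field R K hsu
  have hker : Function.Bijective (RingHom.quotientKerEquivOfSurjective hφ) := RingEquiv.bijective _
  haveI : (RingHom.ker φ).IsMaximal := RingHom.ker_isMaximal_of_surjective φ hφ
  exact frob_poly R K L p (RingHom.ker φ) (by
    rw [Nat.card_congr (RingHom.quotientKerEquivOfSurjective hφ).toEquiv, Nat.card_zmod]) f hf hs

set_option linter.unusedSimpArgs false
def RR {K : Type*} [CommRing K] (x w : K) : K :=
  18225000 * (x + 1) * (x - 179) * (x ^ 3 - 12 * x ^ 2 + 648 * x - 464) *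
    (2 * w * (x ^ 7 + 15 * x ^ 6 + 420 * x ^ 5 - 4800 * x ^ 4 - 124560 * x ^ 3 + 783616 * x ^ 2 + 2920320 * x + 2073600)
    + 10 * (x + 1) * (7 * x ^ 7 - 132 * x ^ 6 + 6912 * x ^ 5 - 74352 * x ^ 4 + 822272 * x ^ 3 -
        1104000 * x ^ 2 - 22464000 * x - 24883200))

def u0 {K : Type*} [CommRing K] (x : K) : K :=
  -77075968 + 138635776 * x ^ 1 + 60196736 * x ^ 2 - 148753088 * x ^ 3 + 6213440 * x ^ 4 - 537008 * x ^ 5 + 11066 * x ^ 6 - 404 * x ^ 7 + 2 * x ^ 8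

def u2 {K : Type*} [CommRing K] (x w : K) : K :=
  (-29856168960 - 82826083200 * x ^ 1 - 52638263520 * x ^ 2 - 120697680 * x ^ 3 - 430490400 * x ^ 4 + 21170040 * x ^ 5 - 665925 * x ^ 6 + 21930 * x ^ 7 - 105 * x ^ 8) + (536140800 + 1026756000 * x ^ 1 + 446616000 * x ^ 2 - 42480000 * x ^ 3 + 1512000 * x ^ 4 - 7200 * x ^ 5) * w

def u3 {K : Type*} [CommRing K] (x w : K) : K :=
  (-298227916800 - 382548902400 * x ^ 1 - 52889097600 * x ^ 2 + 28312920000 * x ^ 3 - 3055104000 * x ^ 4 + 60100200 * x ^ 5 - 3753900 * x ^ 6 + 9900 * x ^ 7) + (4970465280 + 3956734080 * x ^ 1 - 539668800 * x ^ 2 + 11829600 * x ^ 3 - 6661800 * x ^ 4 - 53820 * x ^ 5 + 180 * x ^ 6) * w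

def u4 {K : Type*} [CommRing K] (x w : K) : K :=
  (-117974016000 - 189374054400 * x ^ 1 - 17041305600 * x ^ 2 + 52427404800 * x ^ 3 - 2077776000 * x ^ 4 - 145206000 * x ^ 5 + 975600 * x ^ 6 - 264600 * x ^ 7 + 1800 * x ^ 8) + (1966233600 + 2569420800 * x ^ 1 - 1663056000 * x ^ 2 + 445320000 * x ^ 3 - 22050000 * x ^ 4 + 138600 * x ^ 5 + 1800 * x ^ 6) * w

def u5 {K : Type*} [CommRing K] (x w : K) : K :=
  (1037684736000 + 1645417728000 * x ^ 1 + 403042752000 * x ^ 2 - 190418400000 * x ^ 3 + 13798080000 * x ^ 4 - 456804000 * x ^ 5 + 16758000 * x ^ 6 - 198000 * x ^ 7) + (-17294745600 - 19643097600 * x ^ 1 + 2727072000 * x ^ 2 - 361008000 * x ^ 3 + 30852000 * x ^ 4 - 219600 * x ^ 5 - 3600 * x ^ 6) * w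

def u6 {K : Type*} [CommRing K] (x w : K) : K :=
  (665458688000 + 2265002752000 * x ^ 1 + 1274261696000 * x ^ 2 - 310673120000 * x ^ 3 + 14658560000 * x ^ 4 + 49768000 * x ^ 5 + 1082000 * x ^ 6 + 616000 * x ^ 7 - 10000 * x ^ 8) + (-16229376000 - 20483136000 * x ^ 1 - 9288000000 * x ^ 2 - 1349280000 * x ^ 3 + 39240000 * x ^ 4 - 756000 * x ^ 5 - 36000 * x ^ 6) * w

def v1 {K : Type*} [CommRing K] (x w : K) : K :=
  (829231104 - 399245952 * x ^ 1 - 1106335296 * x ^ 2 + 115225440 * x ^ 3 - 6687960 * x ^ 4 + 222984 * x ^ 5 - 5352 * x ^ 6 + 24 * x ^ 7) + (-9966720 + 4008000 * x ^ 1 + 13639200 * x ^ 2 - 312600 * x ^ 3 + 22800 * x ^ 4 - 120 * x ^ 5) * w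

def v2 {K : Type*} [CommRing K] (x w : K) : K :=
  (-23169530880 - 23744979840 * x ^ 1 + 108030240 * x ^ 2 + 644112000 * x ^ 3 - 38180400 * x ^ 4 + 1138320 * x ^ 5 - 48240 * x ^ 6 + 240 * x ^ 7) + (386158848 + 202246368 * x ^ 1 - 44144880 * x ^ 2 + 2903760 * x ^ 3 - 175980 * x ^ 4 + 363 * x ^ 5 + 3 * x ^ 6) * w

def v3 {K : Type*} [CommRing K] (x w : K) : K :=
  (-87301263360 - 133927319040 * x ^ 1 - 33970942080 * x ^ 2 + 474081600 * x ^ 3 + 119544000 * x ^ 4 - 1098360 * x ^ 5 + 199860 * x ^ 6 - 780 * x ^ 7) + (1300869120 + 1930416000 * x ^ 1 - 252283200 * x ^ 2 + 14325600 * x ^ 3 + 94200 * x ^ 4 + 1020 * x ^ 5) * w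

def v4 {K : Type*} [CommRing K] (x w : K) : K :=
  (-103460659200 + 9738854400 * x ^ 1 + 30222835200 * x ^ 2 - 8204400000 * x ^ 3 + 938688000 * x ^ 4 - 21193200 * x ^ 5 + 1139400 * x ^ 6 - 7800 * x ^ 7) + (1724344320 - 989214720 * x ^ 1 + 105964800 * x ^ 2 - 3499200 * x ^ 3 + 1851600 * x ^ 4 - 480 * x ^ 5 - 120 * x ^ 6) * w

def v5 {K : Type*} [CommRing K] (x w : K) : K :=
  (331415961600 + 461528678400 * x ^ 1 + 273456576000 * x ^ 2 - 4264032000 * x ^ 3 + 16464000 * x ^ 4 + 1461600 * x ^ 5 - 387600 * x ^ 6 + 6000 * x ^ 7) + (-3982080000 - 9523622400 * x ^ 1 + 1160390400 * x ^ 2 - 41894400 * x ^ 3 - 549600 * x ^ 4 + 27600 * x ^ 5) * w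

def v6 {K : Type*} [CommRing K] (x w : K) : K :=
  (647202816000 + 543830784000 * x ^ 1 - 155465280000 * x ^ 2 + 42540480000 * x ^ 3 - 3657120000 * x ^ 4 + 119736000 * x ^ 5 - 4356000 * x ^ 6 + 60000 * x ^ 7) + (-10786713600 - 3216576000 * x ^ 1 + 1352467200 * x ^ 2 - 24307200 * x ^ 3 - 3100800 * x ^ 4 + 37200 * x ^ 5 + 1200 * x ^ 6) * w

lemma ct0 {K : Type*} [CommRing K] (x w R : K) (hw : w ^ 2 = 5 * (x + 1) * (x ^ 2 - 8 * x + 720))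
    (hR : R = RR x w) :
    (u0 x) ^ 2 - 5 * (x + 1) * (0) = (1) * (u0 x) ^ 2 - (0) * R := by
  subst hR
  simp only [RR, u0, u2, u3, u4, u5, u6, v1, v2, v3, v4, v5, v6]
  linear_combination (0) * hw

lemma ct1 {K : Type*} [CommRing K] (x w R : K) (hw : w ^ 2 = 5 * (x + 1) * (x ^ 2 - 8 * x + 720))
    (hR : R = RR x w) :
    0 - 5 * (x + 1) * (0) = (0) * (u0 x) ^ 2 - (0) * R := by
  subst hR
  simp only [RR, u0, u2, u3, u4, u5, u6, v1, v2, v3, v4, v5, v6]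
  linear_combination (0) * hw

lemma ct2 {K : Type*} [CommRing K] (x w R : K) (hw : w ^ 2 = 5 * (x + 1) * (x ^ 2 - 8 * x + 720))
    (hR : R = RR x w) :
    2 * (u0 x) * (u2 x w) - 5 * (x + 1) * ((v1 x w) ^ 2) = (-105) * (u0 x) ^ 2 - (0) * R := by
  subst hR
  simp only [RR, u0, u2, u3, u4, u5, u6, v1, v2, v3, v4, v5, v6]
  linear_combination ((-496677537792000) + (-97211400192000) * x ^ 1 + (1678526691840000) * x ^ 2 + (701245451520000) * x ^ 3 + (-1493152565760000) * x ^ 4 + (-873627107904000) * x ^ 5 + (38116833336000) * x ^ 6 + (-3505881960000) * x ^ 7 + (84665520000) * x ^ 8 + (-2946960000) * x ^ 9 + (27288000) * x ^ 10 + (-72000) * x ^ 11) * hw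

lemma ct3 {K : Type*} [CommRing K] (x w R : K) (hw : w ^ 2 = 5 * (x + 1) * (x ^ 2 - 8 * x + 720))
    (hR : R = RR x w) :
    2 * (u0 x) * (u3 x w) - 5 * (x + 1) * (2 * (v1 x w) * (v2 x w)) = (0) * (u0 x) ^ 2 - (1) * R := by
  subst hR
  simp only [RR, u0, u2, u3, u4, u5, u6, v1, v2, v3, v4, v5, v6]
  linear_combination ((38487371135385600) + (43167453716275200) * x ^ 1 + (-60494726028902400) * x ^ 2 + (-89493726256128000) * x ^ 3 + (-17887653379008000) * x ^ 4 + (5858658414835200) * x ^ 5 + (-529232956329600) * x ^ 6 + (42058121011200) * x ^ 7 + (-1270441638000) * x ^ 8 + (44048952000) * x ^ 9 + (-284810400) * x ^ 10 + (-244800) * x ^ 11 + (3600) * x ^ 12) * hw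

lemma ct4 {K : Type*} [CommRing K] (x w R : K) (hw : w ^ 2 = 5 * (x + 1) * (x ^ 2 - 8 * x + 720))
    (hR : R = RR x w) :
    2 * (u0 x) * (u4 x w) + (u2 x w) ^ 2 - 5 * (x + 1) * (2 * (v1 x w) * (v3 x w) + (v2 x w) ^ 2) = (4500) * (u0 x) ^ 2 - (-6) * R := by
  subst hR
  simp only [RR, u0, u2, u3, u4, u5, u6, v1, v2, v3, v4, v5, v6]
  linear_combination ((-328492339261931520) + (-155699651762012160) * x ^ 1 + (578401899803504640) * x ^ 2 + (387969422977658880) * x ^ 3 + (-31119765210604800) * x ^ 4 + (-11750242945674240) * x ^ 5 + (1563061344770880) * x ^ 6 + (-161901325501920) * x ^ 7 + (4583284626960) * x ^ 8 + (-186500089800) * x ^ 9 + (489859155) * x ^ 10 + (5833665) * x ^ 11 + (-10935) * x ^ 12 + (-45) * x ^ 13) * hw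

lemma ct5 {K : Type*} [CommRing K] (x w R : K) (hw : w ^ 2 = 5 * (x + 1) * (x ^ 2 - 8 * x + 720))
    (hR : R = RR x w) :
    2 * (u0 x) * (u5 x w) + 2 * (u2 x w) * (u3 x w) - 5 * (x + 1) * (2 * (v1 x w) * (v4 x w) + 2 * (v2 x w) * (v3 x w)) = (0) * (u0 x) ^ 2 - (0) * R := by
  subst hR
  simp only [RR, u0, u2, u3, u4, u5, u6, v1, v2, v3, v4, v5, v6]
  linear_combination ((478177825613414400) + (-655054105957171200) * x ^ 1 + (-807527149881753600) * x ^ 2 + (880801201525248000) * x ^ 3 + (406915558080768000) * x ^ 4 + (-139703479502515200) * x ^ 5 + (7938411901977600) * x ^ 6 + (-523902858163200) * x ^ 7 + (14664280608000) * x ^ 8 + (-398910942000) * x ^ 9 + (4319105400) * x ^ 10 + (17488800) * x ^ 11 + (-174600) * x ^ 12) * hw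

lemma ct6 {K : Type*} [CommRing K] (x w R : K) (hw : w ^ 2 = 5 * (x + 1) * (x ^ 2 - 8 * x + 720))
    (hR : R = RR x w) :
    2 * (u0 x) * (u6 x w) + 2 * (u2 x w) * (u4 x w) + (u3 x w) ^ 2 - 5 * (x + 1) * (2 * (v1 x w) * (v5 x w) + 2 * (v2 x w) * (v4 x w) + (v3 x w) ^ 2) = (-100000) * (u0 x) ^ 2 - (192) * R := by
  subst hR
  simp only [RR, u0, u2, u3, u4, u5, u6, v1, v2, v3, v4, v5, v6]
  linear_combination ((11296987947977932800) + (5040292174656307200) * x ^ 1 + (-21986454649208832000) * x ^ 2 + (-11688101795961446400) * x ^ 3 + (4040580411952128000) * x ^ 4 + (-231658862175590400) * x ^ 5 + (-19703854397721600) * x ^ 6 + (3176843039424000) * x ^ 7 + (-102855320812800) * x ^ 8 + (4492920348000) * x ^ 9 + (-8181043200) * x ^ 10 + (-281908800) * x ^ 11 + (486000) * x ^ 12 + (3600) * x ^ 13) * hw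

lemma ct7 {K : Type*} [CommRing K] (x w R : K) (hw : w ^ 2 = 5 * (x + 1) * (x ^ 2 - 8 * x + 720))
    (hR : R = RR x w) :
    2 * (u2 x w) * (u5 x w) + 2 * (u3 x w) * (u4 x w) - 5 * (x + 1) * (2 * (v1 x w) * (v6 x w) + 2 * (v2 x w) * (v5 x w) + 2 * (v3 x w) * (v4 x w)) = (0) * (u0 x) ^ 2 - (-96) * R := by
  subst hR
  simp only [RR, u0, u2, u3, u4, u5, u6, v1, v2, v3, v4, v5, v6]
  linear_combination ((-7128035869851648000) + (917908173029376000) * x ^ 1 + (10165156251254784000) * x ^ 2 + (3833153339443200000) * x ^ 3 + (-1061171505607680000) * x ^ 4 + (-267989327801856000) * x ^ 5 + (13388840220672000) * x ^ 6 + (-2563328581632000) * x ^ 7 + (38470852800000) * x ^ 8 + (-2994063480000) * x ^ 9 + (-12630708000) * x ^ 10 + (-284904000) * x ^ 11 + (2484000) * x ^ 12) * hw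

lemma ct8 {K : Type*} [CommRing K] (x w R : K) (hw : w ^ 2 = 5 * (x + 1) * (x ^ 2 - 8 * x + 720))
    (hR : R = RR x w) :
    2 * (u2 x w) * (u6 x w) + 2 * (u3 x w) * (u5 x w) + (u4 x w) ^ 2 - 5 * (x + 1) * (2 * (v2 x w) * (v6 x w) + 2 * (v3 x w) * (v5 x w) + (v4 x w) ^ 2) = (1200000) * (u0 x) ^ 2 - (-1728) * R := by
  subst hR
  simp only [RR, u0, u2, u3, u4, u5, u6, v1, v2, v3, v4, v5, v6]
  linear_combination ((-106873570398044160000) + (-46675282193547264000) * x ^ 1 + (224435318827696128000) * x ^ 2 + (95106287506747392000) * x ^ 3 + (-52323956848051200000) * x ^ 4 + (4408920478909440000) * x ^ 5 + (37413991348992000) * x ^ 6 + (-19665976569984000) * x ^ 7 + (671844763584000) * x ^ 8 + (-30885188400000) * x ^ 9 + (-44529300000) * x ^ 10 + (5328756000) * x ^ 11 + (-4212000) * x ^ 12 + (-108000) * x ^ 13) * hw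

lemma ct9 {K : Type*} [CommRing K] (x w R : K) (hw : w ^ 2 = 5 * (x + 1) * (x ^ 2 - 8 * x + 720))
    (hR : R = RR x w) :
    2 * (u3 x w) * (u6 x w) + 2 * (u4 x w) * (u5 x w) - 5 * (x + 1) * (2 * (v3 x w) * (v6 x w) + 2 * (v4 x w) * (v5 x w)) = (0) * (u0 x) ^ 2 - (512) * R := by
  subst hR
  simp only [RR, u0, u2, u3, u4, u5, u6, v1, v2, v3, v4, v5, v6]
  linear_combination ((-20360323069378560000) + (85713528058675200000) * x ^ 1 + (12586998466805760000) * x ^ 2 + (-105583406013849600000) * x ^ 3 + (-35777168427110400000) * x ^ 4 + (9024331370158080000) * x ^ 5 + (-471341875046400000) * x ^ 6 + (38007702558720000) * x ^ 7 + (-735817305600000) * x ^ 8 + (30703413600000) * x ^ 9 + (42794640000) * x ^ 10 + (-201600000) * x ^ 11 + (-5040000) * x ^ 12) * hw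

lemma ct10 {K : Type*} [CommRing K] (x w R : K) (hw : w ^ 2 = 5 * (x + 1) * (x ^ 2 - 8 * x + 720))
    (hR : R = RR x w) :
    2 * (u4 x w) * (u6 x w) + (u5 x w) ^ 2 - 5 * (x + 1) * (2 * (v4 x w) * (v6 x w) + (v5 x w) ^ 2) = (-7200000) * (u0 x) ^ 2 - (6144) * R := by
  subst hR
  simp only [RR, u0, u2, u3, u4, u5, u6, v1, v2, v3, v4, v5, v6]
  linear_combination ((342002014216519680000) + (191733400169349120000) * x ^ 1 + (-677756709303091200000) * x ^ 2 + (-419337380536565760000) * x ^ 3 + (140533152296140800000) * x ^ 4 + (-17601435028131840000) * x ^ 5 + (-110939762626560000) * x ^ 6 + (48509476992000000) * x ^ 7 + (-1765622776320000) * x ^ 8 + (64809748800000) * x ^ 9 + (776652480000) * x ^ 10 + (-40639680000) * x ^ 11 + (-64800000) * x ^ 12 + (1440000) * x ^ 13) * hw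

lemma ct11 {K : Type*} [CommRing K] (x w R : K) (hw : w ^ 2 = 5 * (x + 1) * (x ^ 2 - 8 * x + 720))
    (hR : R = RR x w) :
    2 * (u5 x w) * (u6 x w) - 5 * (x + 1) * (2 * (v5 x w) * (v6 x w)) = (0) * (u0 x) ^ 2 - (-768) * R := by
  subst hR
  simp only [RR, u0, u2, u3, u4, u5, u6, v1, v2, v3, v4, v5, v6]
  linear_combination ((131830293410611200000) + (-238816381206528000000) * x ^ 1 + (-245228419960012800000) * x ^ 2 + (344892495281356800000) * x ^ 3 + (155883027264307200000) * x ^ 4 + (-22424299645132800000) * x ^ 5 + (1233021889843200000) * x ^ 6 + (-74483922124800000) * x ^ 7 + (1298247436800000) * x ^ 8 + (-35285212800000) * x ^ 9 + (-612504000000) * x ^ 10 + (17251200000) * x ^ 11 + (-72000000) * x ^ 12) * hw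

lemma ct12 {K : Type*} [CommRing K] (x w R : K) (hw : w ^ 2 = 5 * (x + 1) * (x ^ 2 - 8 * x + 720))
    (hR : R = RR x w) :
    (u6 x w) ^ 2 - 5 * (x + 1) * ((v6 x w) ^ 2) = (16000000) * (u0 x) ^ 2 - (-7680) * R := by
  subst hR
  simp only [RR, u0, u2, u3, u4, u5, u6, v1, v2, v3, v4, v5, v6]
  linear_combination ((-318373306092748800000) + (-263871760682188800000) * x ^ 1 + (468227865703219200000) * x ^ 2 + (559326824128512000000) * x ^ 3 + (170887249758412800000) * x ^ 4 + (13452095947161600000) * x ^ 5 + (1397102381107200000) * x ^ 6 + (-51282379238400000) * x ^ 7 + (2975126284800000) * x ^ 8 + (-15999667200000) * x ^ 9 + (-778269600000) * x ^ 10 + (84276000000) * x ^ 11 + (842400000) * x ^ 12 + (-7200000) * x ^ 13) * hw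

open Polynomial in
noncomputable def pU {K : Type*} [CommRing K] (x w : K) : K[X] :=
  C (u0 x) * X ^ 6 + C (u2 x w) * X ^ 4 + C (u3 x w) * X ^ 3 + C (u4 x w) * X ^ 2 + C (u5 x w) * X + C (u6 x w)

open Polynomial in
noncomputable def pV {K : Type*} [CommRing K] (x w : K) : K[X] :=
  C (v1 x w) * X ^ 5 + C (v2 x w) * X ^ 4 + C (v3 x w) * X ^ 3 + C (v4 x w) * X ^ 2 + C (v5 x w) * X + C (v6 x w)

open Polynomial in
noncomputable def pF {K : Type*} [CommRing K] (ρ : K) : K[X] :=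
  (X ^ 2 - 20) ^ 5 * (X ^ 2 - 5) - C ρ * ((X ^ 2 - 4) ^ 3 * ((X - 2) ^ 3 + 128))

open Polynomial in
lemma pF_cert {K : Type*} [CommRing K] (x w ρ : K) (hw : w ^ 2 = 5 * (x + 1) * (x ^ 2 - 8 * x + 720))
    (hR : u0 x ^ 2 * ρ = RR x w) :
    C (u0 x ^ 2) * pF ρ = pU x w ^ 2 - C (5 * (x + 1)) * pV x w ^ 2 := by
  have h0 := congrArg C (ct0 x w _ hw hR)
  have h1 := congrArg C (ct1 x w _ hw hR)
  have h2 := congrArg C (ct2 x w _ hw hR)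
  have h3 := congrArg C (ct3 x w _ hw hR)
  have h4 := congrArg C (ct4 x w _ hw hR)
  have h5 := congrArg C (ct5 x w _ hw hR)
  have h6 := congrArg C (ct6 x w _ hw hR)
  have h7 := congrArg C (ct7 x w _ hw hR)
  have h8 := congrArg C (ct8 x w _ hw hR)
  have h9 := congrArg C (ct9 x w _ hw hR)
  have h10 := congrArg C (ct10 x w _ hw hR)
  have h11 := congrArg C (ct11 x w _ hw hR)
  have h12 := congrArg C (ct12 x w _ hw hR)
  simp only [map_add, map_sub, map_mul, map_pow, map_neg, map_ofNat, map_one, map_zero] at h0 h1 h2 h3 h4 h5 h6 h7 h8 h9 h10 h11 h12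
  simp only [pF, pU, pV, map_add, map_mul, map_pow, map_ofNat, map_one]
  linear_combination -h0 * X ^ 12 - h1 * X ^ 11 - h2 * X ^ 10 - h3 * X ^ 9 - h4 * X ^ 8 - h5 * X ^ 7 - h6 * X ^ 6
    - h7 * X ^ 5 - h8 * X ^ 4 - h9 * X ^ 3 - h10 * X ^ 2 - h11 * X - h12

open Polynomial in
lemma pU_eval_map {K : Type*} [CommRing K] (s : K →+* K) (x w y : K) :
    (pU (s x) (s w)).eval (s y) = s ((pU x w).eval y) := by
  simp only [eval_add, eval_mul, eval_pow, eval_C, eval_X, pU]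
  simp only [map_add, map_sub, map_mul, map_pow, map_neg, map_ofNat, u0, u2, u3, u4, u5, u6]

open Polynomial in
lemma pV_eval_map {K : Type*} [CommRing K] (s : K →+* K) (x w y : K) :
    (pV (s x) (s w)).eval (s y) = s ((pV x w).eval y) := by
  simp only [eval_add, eval_mul, eval_pow, eval_C, eval_X, pV]
  simp only [map_add, map_sub, map_mul, map_pow, map_neg, map_ofNat, v1, v2, v3, v4, v5, v6]

open Polynomial in
lemma pU_deg {K : Type*} [CommRing K] (x w : K) : (pU x w).natDegree ≤ 6 := by
  unfold pU; compute_degree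

open Polynomial in
lemma pV_deg {K : Type*} [CommRing K] (x w : K) : (pV x w).natDegree ≤ 5 := by
  unfold pV; compute_degree

open Polynomial in
lemma pU_coeff {K : Type*} [CommRing K] (x w : K) : (pU x w).coeff 6 = u0 x := by
  simp [pU, coeff_X, coeff_C]

open Polynomial in
lemma sgn {L Y : Type*} [Field L] [CharZero L] [Fintype Y] (U V F : L[X]) (γ Δ : L) (hγ : γ ≠ 0)
    (hid : C (γ ^ 2) * F = U ^ 2 - C Δ * V ^ 2) (hU : U.natDegree ≤ 6) (hc : U.coeff 6 = γ)
    (hV : V.natDegree ≤ 5) (hY : Fintype.card Y = 12) (ι : Y → L) (hι : Function.Injective ι)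
    (hr : ∀ y, F.eval (ι y) = 0) (hd : ∀ y, F.derivative.eval (ι y) ≠ 0) (y0 : Y) :
    ∃ e : Y → ℤ, (∀ y, e y = 1 ∨ e y = -1) ∧ ∑ y, e y = 0 ∧
      ∀ y y', (e y * e y' = 1 ∨ e y * e y' = -1) ∧ (e y * e y' = 1 ↔
        U.eval (ι y) * V.eval (ι y') = U.eval (ι y') * V.eval (ι y)) := by
  classical
  have h1 : ∀ y, U.eval (ι y) ^ 2 = Δ * V.eval (ι y) ^ 2 := by
    intro y
    have := congrArg (eval (ι y)) hid
    simp only [eval_mul, eval_sub, eval_pow, eval_C, hr] at this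
    linear_combination -this
  have hV0 : ∀ y, V.eval (ι y) ≠ 0 := by
    intro y hy
    have hu : U.eval (ι y) = 0 := by
      have := h1 y
      rw [hy] at this
      simpa using this
    have := congrArg (fun P => eval (ι y) (derivative P)) hid
    simp [derivative_pow, hu, hy, hγ, hd] at this
  set v := U.eval (ι y0) / V.eval (ι y0) with hv
  have hv2 : v ^ 2 = Δ := by
    rw [hv, div_pow, h1, mul_div_assoc, div_self (pow_ne_zero 2 (hV0 y0)), mul_one]
  have h2 : ∀ y, U.eval (ι y) = v * V.eval (ι y) ∨ U.eval (ι y) = -v * V.eval (ι y) := by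
    intro y
    have : (U.eval (ι y)) ^ 2 = (v * V.eval (ι y)) ^ 2 := by rw [h1, mul_pow, hv2]
    rcases sq_eq_sq_iff_eq_or_eq_neg.mp this with h | h
    · exact Or.inl h
    · right; rw [h]; ring
  have hbound : ∀ c : L, (Finset.univ.filter (fun y => U.eval (ι y) = c * V.eval (ι y))).card ≤ 6 := by
    intro c
    set P := U - C c * V with hP
    have hPc : P.coeff 6 = γ := by
      have : V.coeff 6 = 0 := coeff_eq_zero_of_natDegree_lt (by omega)
      simp [hP, hc, this]
    have hP0 : P ≠ 0 := by
      intro h; rw [h] at hPc; exact hγ (by simpa using hPc.symm)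
    have hPd : P.natDegree ≤ 6 := by
      refine (natDegree_sub_le _ _).trans (max_le hU ?_)
      exact (natDegree_C_mul_le _ _).trans (by omega)
    calc _ = ((Finset.univ.filter (fun y => U.eval (ι y) = c * V.eval (ι y))).image ι).card :=
          (Finset.card_image_of_injective _ hι).symm
      _ ≤ P.roots.toFinset.card := by
          apply Finset.card_le_card
          intro z hz
          obtain ⟨y, hy, rfl⟩ := Finset.mem_image.mp hz
          rw [Multiset.mem_toFinset, mem_roots hP0, IsRoot, hP]
          simp [(Finset.mem_filter.mp hy).2]
      _ ≤ P.roots.card := Multiset.toFinset_card_le _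
      _ ≤ 6 := (card_roots' P).trans hPd
  by_cases hv0 : v = 0
  · have := hbound 0
    have h3 : (Finset.univ.filter (fun y => U.eval (ι y) = 0 * V.eval (ι y))) = Finset.univ := by
      apply Finset.filter_true_of_mem
      intro y _
      rcases h2 y with h | h <;> simpa [hv0] using h
    rw [h3, Finset.card_univ, hY] at this
    omega
  have hne : ∀ y, U.eval (ι y) = v * V.eval (ι y) → U.eval (ι y) = -v * V.eval (ι y) → False := by
    intro y ha hb
    have : 2 * (v * V.eval (ι y)) = 0 := by linear_combination hb - ha
    simp [hv0, hV0 y] at this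
  refine ⟨fun y => if U.eval (ι y) = v * V.eval (ι y) then 1 else -1, ?_, ?_, ?_⟩
  · intro y; dsimp only; split_ifs <;> simp
  · have hA := hbound v
    have hB := hbound (-v)
    have hs : (Finset.univ.filter (fun y => U.eval (ι y) = -v * V.eval (ι y))) =
        (Finset.univ.filter (fun y => ¬ U.eval (ι y) = v * V.eval (ι y))) := by
      apply Finset.filter_congr
      intro y _
      constructor
      · intro h h'; exact hne y h' h
      · intro h; exact (h2 y).resolve_left h
    rw [hs] at hB
    have hT := Finset.card_filter_add_card_filter_not (s := Finset.univ) (fun y => U.eval (ι y) = v * V.eval (ι y))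
    rw [Finset.card_univ, hY] at hT
    rw [Finset.sum_ite]
    simp only [Finset.sum_const]
    have : (Finset.univ.filter (fun y => U.eval (ι y) = v * V.eval (ι y))).card = 6 := by omega
    have h' : (Finset.univ.filter (fun y => ¬ U.eval (ι y) = v * V.eval (ι y))).card = 6 := by omega
    rw [this, h']
    norm_num
  · intro y y'
    have a := hne y
    have b := hne y'
    have e1 := hV0 y
    have e2 := hV0 y'
    rcases h2 y with h | h <;> rcases h2 y' with h' | h'
    · simp only [h, h', if_true]
      refine ⟨by simp, ?_⟩
      simp only [mul_one, true_iff]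
      ring
    · have h'' : ¬ U.eval (ι y') = v * V.eval (ι y') := fun q => b q h'
      simp only [h, h'', if_true, if_false]
      refine ⟨by simp, ?_⟩
      constructor
      · intro q; norm_num at q
      · intro q
        rw [h'] at q
        have : 2 * (v * V.eval (ι y) * V.eval (ι y')) = 0 := by linear_combination q
        simp [hv0, e1, e2] at this
    · have h'' : ¬ U.eval (ι y) = v * V.eval (ι y) := fun q => a q h
      simp only [h', h'', if_true, if_false]
      refine ⟨by simp, ?_⟩
      constructor
      · intro q; norm_num at q
      · intro q
        rw [h] at q
        have : 2 * (v * V.eval (ι y) * V.eval (ι y')) = 0 := by linear_combination -q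
        simp [hv0, e1, e2] at this
    · have h'' : ¬ U.eval (ι y') = v * V.eval (ι y') := fun q => b q h'
      have h3 : ¬ U.eval (ι y) = v * V.eval (ι y) := fun q => a q h
      simp only [h3, h'', if_false]
      refine ⟨by simp, ?_⟩
      rw [h, h']
      constructor
      · intro _; ring
      · intro _; norm_num

def sS {K : Type*} [CommRing K] (x : K) : K :=
  x ^ 7 + 15 * x ^ 6 + 420 * x ^ 5 - 4800 * x ^ 4 - 124560 * x ^ 3 + 783616 * x ^ 2 + 2920320 * x + 2073600

def gB {K : Type*} [CommRing K] (x : K) : K :=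
  (x + 1) * (7 * x ^ 7 - 132 * x ^ 6 + 6912 * x ^ 5 - 74352 * x ^ 4 + 822272 * x ^ 3 -
        1104000 * x ^ 2 - 22464000 * x - 24883200)

def gC {K : Type*} [CommRing K] (x : K) : K :=
  (x + 1) * (x - 179) * (x ^ 3 - 12 * x ^ 2 + 648 * x - 464) ^ 3

def ww {K : Type*} [Field K] (T x : K) : K := 5 * (2 * (x ^ 5 * (x - 8)) * T + gB x) / sS x

lemma theta_trans {L : Type*} [Field L] [CharZero L] (x T : L) (hT : Transcendental ℚ T)
    (h : gC x - 20 * gB x * T - 20 * (x ^ 5 * (x - 8)) * T ^ 2 = 0) : Transcendental ℚ x := by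
  intro hx
  apply hT
  set A := algebraicClosure ℚ L
  have hxA : x ∈ A := by rwa [mem_algebraicClosure_iff]
  obtain ⟨a, ha⟩ : ∃ a : A, (a : L) = x := ⟨⟨x, hxA⟩, rfl⟩
  have : Algebra.IsAlgebraic ℚ A := algebraicClosure.isAlgebraic ℚ L
  suffices IsAlgebraic A T from this.restrictScalars ℚ
  refine ⟨Polynomial.C (gC a) - Polynomial.C (20 * gB a) * Polynomial.X -
    Polynomial.C (20 * (a ^ 5 * (a - 8))) * Polynomial.X ^ 2, ?_, ?_⟩
  · intro h0
    have h1 := congrArg (fun P => Polynomial.coeff P 1) h0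
    have h2 := congrArg (fun P => Polynomial.coeff P 2) h0
    simp only [Polynomial.coeff_sub, Polynomial.coeff_C_mul, Polynomial.coeff_X_pow, Polynomial.coeff_C, Polynomial.coeff_X, Polynomial.coeff_zero] at h1 h2
    norm_num at h1 h2
    rcases h2 with h2 | h2
    · rw [h2] at h1
      norm_num [gB] at h1
    · rw [sub_eq_zero] at h2
      rw [h2] at h1
      norm_num [gB] at h1
  · simp only [map_sub, map_mul, map_pow, Polynomial.aeval_C, Polynomial.aeval_X]
    rw [← h, ← ha]
    have e : ∀ b : A, algebraMap A L b = (b : L) := fun b => rfl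
    rw [← e a]
    simp only [gC, gB, map_add, map_sub, map_mul, map_pow, map_ofNat, map_one]

lemma theta {L : Type*} [Field L] [CharZero L] (x T : L) (hT : Transcendental ℚ T)
    (h : gC x - 20 * gB x * T - 20 * (x ^ 5 * (x - 8)) * T ^ 2 = 0) :
    ww T x ^ 2 = 5 * (x + 1) * (x ^ 2 - 8 * x + 720) ∧ u0 x ^ 2 * (4556250 / T) = RR x (ww T x) ∧ u0 x ≠ 0 := by
  have hx := theta_trans x T hT h
  have hT0 : T ≠ 0 := by
    rintro rfl
    exact hT isAlgebraic_zero
  have hS : sS x ≠ 0 := by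
    intro h0
    refine hx ⟨(sS Polynomial.X : Polynomial ℚ), ?_, by simpa [sS, map_ofNat] using h0⟩
    intro h1
    have := congrArg (Polynomial.eval 0) h1
    simp [sS] at this
  have hU : u0 x ≠ 0 := by
    intro h0
    refine hx ⟨(u0 Polynomial.X : Polynomial ℚ), ?_, by simpa [u0, map_ofNat] using h0⟩
    intro h1
    have := congrArg (Polynomial.eval 0) h1
    simp [u0] at this
  have e : ww T x * sS x = 5 * (2 * (x ^ 5 * (x - 8)) * T + gB x) := by
    unfold ww; field_simp
  refine ⟨?_, ?_, hU⟩
  · apply mul_right_cancel₀ (pow_ne_zero 2 hS)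
    rw [← mul_pow, e]
    simp only [sS, gB, gC] at *
    linear_combination -5 * (x ^ 5 * (x - 8)) * h
  · have : RR x (ww T x) = 18225000 * (x + 1) * (x - 179) * (x ^ 3 - 12 * x ^ 2 + 648 * x - 464) * (2 * (ww T x * sS x) + 10 * gB x) := by
      unfold RR gB sS; ring
    rw [this, e]
    field_simp
    simp only [gC, u0] at *
    linear_combination (18225000 * (x + 1) * (x - 179) * (x ^ 3 - 12 * x ^ 2 + 648 * x - 464)) * h

open Polynomial in
lemma gen_inj {K : Type} [Field K] [CharZero K] (τ : K) (h : Transcendental ℚ τ) :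
    Function.Injective (eval₂RingHom (Int.castRingHom K) τ) := by
  have h' : Transcendental ℤ τ := h.restrictScalars (algebraMap ℤ ℚ).injective_int
  have := transcendental_iff_injective.mp h'
  intro a b hab
  exact this (by simpa [aeval_def] using hab)

open Polynomial in
lemma gen_surj (τ : RatFunc ℚ) (h : (RatFunc.X : RatFunc ℚ) ∈ Subfield.closure {τ}) (z : RatFunc ℚ) :
    ∃ a b : ℤ[X], z = eval₂ (Int.castRingHom (RatFunc ℚ)) τ a / eval₂ (Int.castRingHom (RatFunc ℚ)) τ b := by
  have h1 : ∀ p : ℚ[X], algebraMap ℚ[X] (RatFunc ℚ) p ∈ Subfield.closure {τ} := by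
    intro p
    induction p using Polynomial.induction_on with
    | C a => 
      rw [RatFunc.algebraMap_C]
      have : (RatFunc.C a : RatFunc ℚ) = ((a : ℚ) : RatFunc ℚ) := by simp
      rw [this]
      exact SubfieldClass.ratCast_mem _ a
    | add p q hp hq => rw [map_add]; exact add_mem hp hq
    | monomial n a hp =>
      rw [pow_succ, ← mul_assoc, map_mul, RatFunc.algebraMap_X]
      exact mul_mem hp h
  have h2 : z ∈ Subfield.closure {τ} := by
    rw [← RatFunc.num_div_denom z]
    exact div_mem (h1 _) (h1 _)
  rw [Subfield.mem_closure_iff] at h2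
  have h3 : Subring.closure {τ} ≤ (eval₂RingHom (Int.castRingHom (RatFunc ℚ)) τ).range := by
    rw [Subring.closure_le]
    rintro _ rfl
    exact ⟨X, by simp⟩
  obtain ⟨y, hy, y', hy', rfl⟩ := h2
  obtain ⟨a, rfl⟩ := h3 hy
  obtain ⟨b, rfl⟩ := h3 hy'
  exact ⟨a, b, rfl⟩

lemma tt_trans : Transcendental ℚ (RatFunc.X : RatFunc ℚ) := by
  have := (transcendental_algebraMap_iff (R := ℚ) (IsFractionRing.injective (Polynomial ℚ) (RatFunc ℚ))).mpr (Polynomial.transcendental_X ℚ)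
  simpa using this

lemma rho_trans : Transcendental ℚ (4556250 / RatFunc.X : RatFunc ℚ) := by
  intro h
  apply tt_trans
  have := (isAlgebraic_algebraMap (R := ℚ) (A := RatFunc ℚ) 4556250).mul h.inv
  have e : (RatFunc.X : RatFunc ℚ) = algebraMap ℚ (RatFunc ℚ) 4556250 * (4556250 / RatFunc.X)⁻¹ := by
    rw [map_ofNat]
    field_simp
  rw [e]; exact this

lemma rho_mem : (RatFunc.X : RatFunc ℚ) ∈ Subfield.closure {(4556250 / RatFunc.X : RatFunc ℚ)} := by
  have e : (RatFunc.X : RatFunc ℚ) = 4556250 * (4556250 / RatFunc.X)⁻¹ := by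
    field_simp
  have := mul_mem (ofNat_mem (Subfield.closure {(4556250 / RatFunc.X : RatFunc ℚ)}) 4556250)
    (inv_mem (Subfield.subset_closure (Set.mem_singleton _)))
  rwa [← e] at this

open Polynomial in
noncomputable def pG {K : Type*} [CommRing K] (r : K) : K[X] :=
  (X + 1) * (X - 179) * (X ^ 3 - 12 * X ^ 2 + 648 * X - 464) ^ 3 - C (20 * r) * ((X + 1) *
      (7 * X ^ 7 - 132 * X ^ 6 + 6912 * X ^ 5 - 74352 * X ^ 4 + 822272 * X ^ 3 -
        1104000 * X ^ 2 - 22464000 * X - 24883200)) -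
    C (20 * r ^ 2) * (X ^ 5 * (X - 8))


set_option linter.unusedSimpArgs false
open Polynomial in
lemma pF_eval {K : Type*} [CommRing K] (r z : K) : (pF r).eval z =
    (z ^ 2 - 20) ^ 5 * (z ^ 2 - 5) - r * ((z ^ 2 - 4) ^ 3 * ((z - 2) ^ 3 + 128)) := by
  simp [pF]

open Polynomial in
lemma pF_der {K : Type*} [CommRing K] (r z : K) : (derivative (pF r)).eval z =
    10 * z * (z ^ 2 - 20) ^ 4 * (z ^ 2 - 5) + 2 * z * (z ^ 2 - 20) ^ 5
      - r * (6 * z * (z ^ 2 - 4) ^ 2 * ((z - 2) ^ 3 + 128) + 3 * (z ^ 2 - 4) ^ 3 * (z - 2) ^ 2) := by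
  simp [pF, derivative_pow]
  ring

open Polynomial in
lemma sepF2 {k : Type*} [Field k] (h5 : (5 : k) = 0) (z : k) (hF : (pF (2 : k)).eval z = 0)
    (hd : (derivative (pF (2 : k))).eval z = 0) : False := by
  rw [pF_eval] at hF
  rw [pF_der] at hd
  have : (1 : k) = 0 := by
    linear_combination (-1 - z^3 - z^4 + 2*z^5 + 2*z^7 + z^8 - z^9 - z^10) * hF + (1 + 2*z + z^2 + 2*z^3 - 2*z^4 + 2*z^5 - 2*z^7 + 2*z^9 - 2*z^10 - 2*z^11) * hd
      + (3202765 + 2884608*z + 4327680*z^2 + 5125632*z^3 + 7289408*z^4 - 14460160*z^5 + 2620448*z^6 - 1240512*z^7 - 10430134*z^8 + 5336108*z^9 + 12548953*z^10 - 7635222*z^11 - 9634069*z^12 + 2202277*z^13 + 2442475*z^14 - 262341*z^15 - 276763*z^16 + 15390*z^17 + 15779*z^18 - 449*z^19 - 446*z^20 + 5*z^21 + 5*z^22) * h5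
  exact one_ne_zero this

open Polynomial in
lemma sepF3 {k : Type*} [Field k] (h5 : (5 : k) = 0) (z : k) (hF : (pF (3 : k)).eval z = 0)
    (hd : (derivative (pF (3 : k))).eval z = 0) : False := by
  rw [pF_eval] at hF
  rw [pF_der] at hd
  have : (1 : k) = 0 := by
    linear_combination (1 - 2*z - z^2 - z^3 + 2*z^4 - z^7 + 2*z^8 - 2*z^9 - 2*z^10) * hF + (-1 - 2*z + z^2 - z^4 + 2*z^5 - 2*z^6 - z^7 + z^8 - z^9 + z^10 + z^11) * hd
      + (-3204147 + 3522304*z - 1126912*z^2 + 4167680*z^3 - 6164128*z^4 - 4935456*z^5 + 8681408*z^6 - 1274288*z^7 - 11715021*z^8 + 9632675*z^9 + 7657136*z^10 - 955749*z^11 + 345172*z^12 - 366781*z^13 - 555027*z^14 + 73540*z^15 + 85672*z^16 - 5232*z^17 - 5583*z^18 + 170*z^19 + 170*z^20 - 2*z^21 - 2*z^22) * h5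
  exact one_ne_zero this

open Polynomial in
lemma sepF4 {k : Type*} [Field k] (h5 : (5 : k) = 0) (z : k) (hF : (pF (4 : k)).eval z = 0)
    (hd : (derivative (pF (4 : k))).eval z = 0) : False := by
  rw [pF_eval] at hF
  rw [pF_der] at hd
  have : (1 : k) = 0 := by
    linear_combination (1 + 2*z + z^3 - 2*z^5 - z^6 + z^8 - z^9 - 2*z^10) * hF + (-2 + 2*z - z^2 + z^3 + 2*z^4 - z^5 - 2*z^6 - 2*z^7 - z^8 + 2*z^9 - 2*z^10 + z^11) * hd
      + (-3204915 - 12193792*z + 7221504*z^2 - 1272832*z^3 + 715904*z^4 + 13878784*z^5 - 381664*z^6 - 10907840*z^7 - 9363172*z^8 + 2992832*z^9 + 15683117*z^10 - 6552408*z^11 - 2429463*z^12 + 2067807*z^13 - 204770*z^14 - 255471*z^15 + 64787*z^16 + 15192*z^17 - 4998*z^18 - 433*z^19 + 163*z^20 + 5*z^21 - 2*z^22) * h5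
  exact one_ne_zero this

open Polynomial in
lemma nofix {k : Type*} [Field k] (h7 : (7 : k) = 0) (z : k) (hF : (pF (1 : k)).eval z = 0)
    (hd : z ^ 7 = z) : False := by
  rw [pF_eval] at hF
  have : (1 : k) = 0 := by
    linear_combination (-2 + 2*z + 3*z^2 + 2*z^3 - 3*z^4 + 2*z^5 - 2*z^6) * hF + (3 - 3*z^3 + 3*z^4 - 2*z^5 - z^6 + 2*z^7 + 3*z^8 + 3*z^9 - 2*z^10 + 2*z^11) * hd
      + (4573623 - 4573403*z - 8919552*z^2 - 2515200*z^3 + 10292059*z^4 - 2857499*z^5 + 941522*z^6 + 1744132*z^7 - 1499526*z^8 - 316117*z^9 + 298424*z^10 + 27396*z^11 - 26649*z^12 - 1258*z^13 + 1242*z^14 + 29*z^15 - 30*z^16) * h7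
  exact one_ne_zero this

open Polynomial in
lemma sepG {k : Type*} [Field k] (h3 : (3 : k) = 0) (z : k) (hF : (pG (1 : k)).eval z = 0)
    (hd : (derivative (pG (1 : k))).eval z = 0) : False := by
  simp only [pG, eval_sub, eval_add, eval_mul, eval_pow, eval_X, eval_C, eval_one, eval_ofNat] at hF
  simp only [pG, derivative_sub, derivative_add, derivative_mul, derivative_pow, derivative_X, derivative_C, derivative_one, derivative_ofNat, eval_sub, eval_add, eval_mul, eval_pow, eval_X, eval_C, eval_one, eval_ofNat, eval_zero] at hd
  have : (1 : k) = 0 := by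
    linear_combination (-1 - z + z^2 - z^3 - z^4 - z^5 - z^7 + z^8 - z^9) * hF + (1 - z - z^2 + z^3 - z^4 + z^5 + z^6 - z^7 - z^10) * hd
      + (24856152747 - 52590459904*z - 64849452288*z^2 + 212930814208*z^3 - 80696269984*z^4 - 109394178968*z^5 + 148905402112*z^6 - 148674034372*z^7 + 17733969421*z^8 + 133795797062*z^9 - 100537609437*z^10 + 3083449916*z^11 + 87939398560*z^12 - 84332829442*z^13 + 6221600206*z^14 - 676284125*z^15 + 26851965*z^16 - 1402136*z^17 + 28755*z^18 - 785*z^19 + 4*z^20) * h3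
  exact one_ne_zero this

lemma fr5 {k : Type*} [Field k] [CharP k 5] (z : k) (hz : 2 + 2*z - 2*z^2 - z^3 + z^4 + z^5 = 0) :
    z ^ 5 ^ 5 = z ∧ z ^ 5 ≠ z := by
  have hp5 : (5 : k) = 0 := by exact_mod_cast CharP.cast_eq_zero k 5
  have : Fact (Nat.Prime 5) := ⟨by norm_num⟩
  have hs : ∀ (i : ℕ) (a : k), z ^ 5 ^ i = a → z ^ 5 ^ (i + 1) = frobenius k 5 a := by
    intro i a h
    rw [frobenius_def, ← h, ← pow_mul, pow_succ]
  have h0 : z ^ 5 ^ 0 = z := by simp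
  have h1 : z ^ 5 ^ 1 = -2 - 2*z + 2*z^2 + z^3 - z^4 := by
    rw [hs 0 _ h0]
    simp only [map_add, map_sub, map_neg, map_mul, map_pow, map_ofNat, map_one, frobenius_def]
    try linear_combination (1) * hz + (0) * hp5
  have h2 : z ^ 5 ^ 2 = 1 + 2*z^2 - z^3 := by
    rw [hs 1 _ h1]
    simp only [map_add, map_sub, map_neg, map_mul, map_pow, map_ofNat, map_one, frobenius_def]
    try linear_combination (1 - z + z^2 - z^3 + z^4 - 2*z^6 - 2*z^8 - 2*z^9 + 2*z^10 + z^11 + z^12 - 2*z^13 + z^14 - z^15) * hz + (-1 - z^5 + z^6 + z^7 + z^9 - 2*z^11 + 2*z^13 + z^14 - z^15) * hp5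
  have h3 : z ^ 5 ^ 3 = 2 + 2*z + 2*z^2 - 2*z^3 - z^4 := by
    rw [hs 2 _ h2]
    simp only [map_add, map_sub, map_neg, map_mul, map_pow, map_ofNat, map_one, frobenius_def]
    try linear_combination (2 + 2*z - z^2 + 2*z^4 - 2*z^5 + z^6 + z^7 - 2*z^8 + z^9 - z^10) * hz + (-1 - 2*z + 2*z^3 - z^4 - z^5 + z^6 - z^7 + z^9) * hp5
  have h4 : z ^ 5 ^ 4 = -2 - z - z^2 + 2*z^3 + 2*z^4 := by
    rw [hs 3 _ h3]
    simp only [map_add, map_sub, map_neg, map_mul, map_pow, map_ofNat, map_one, frobenius_def]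
    try linear_combination (2 + z - z^2 + 2*z^3 - 2*z^4 - 2*z^5 + z^6 - 2*z^7 + 2*z^8 + z^9 - z^10 + z^11 + z^12 - 2*z^13 + z^14 - z^15) * hz + (-z + z^2 - z^4 + 2*z^5 - z^7 - z^9 + z^10 + z^11 - z^12 + z^14 - z^15) * hp5
  have h5 : z ^ 5 ^ 5 = z := by
    rw [hs 4 _ h4]
    simp only [map_add, map_sub, map_neg, map_mul, map_pow, map_ofNat, map_one, frobenius_def]
    try linear_combination (-1 - 2*z + z^2 - z^3 - z^4 - z^5 + z^7 + 2*z^8 - 2*z^11 - 2*z^12 - z^13 - 2*z^14 + 2*z^15) * hz + (z - z^3 + z^4 + z^5 - z^7 - z^8 + z^10 + z^11 + z^12 - z^16 + z^17 + z^18) * hp5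
  refine ⟨h5, fun h => one_ne_zero (α := k) ?_⟩
  have h1' : -2 - 2*z + 2*z^2 + z^3 - z^4 = z := by rw [← h1]; simpa using h
  linear_combination (-1 + 2*z + 2*z^2 - z^3) * hz + (1 + 2*z - 2*z^2 - z^4) * h1' + (1 + z - 2*z^2 - 2*z^3 + 2*z^4 - z^6) * hp5

lemma fr2 {k : Type*} [Field k] [CharP k 5] (z : k) (hz : 2 + z^2 = 0) :
    z ^ 5 ^ 2 = z ∧ z ^ 5 ≠ z := by
  have hp5 : (5 : k) = 0 := by exact_mod_cast CharP.cast_eq_zero k 5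
  have : Fact (Nat.Prime 5) := ⟨by norm_num⟩
  have hs : ∀ (i : ℕ) (a : k), z ^ 5 ^ i = a → z ^ 5 ^ (i + 1) = frobenius k 5 a := by
    intro i a h
    rw [frobenius_def, ← h, ← pow_mul, pow_succ]
  have h0 : z ^ 5 ^ 0 = z := by simp
  have h1 : z ^ 5 ^ 1 = -z := by
    rw [hs 0 _ h0]
    simp only [map_add, map_sub, map_neg, map_mul, map_pow, map_ofNat, map_one, frobenius_def]
    try linear_combination (-2*z + z^3) * hz + (z) * hp5
  have h2 : z ^ 5 ^ 2 = z := by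
    rw [hs 1 _ h1]
    simp only [map_add, map_sub, map_neg, map_mul, map_pow, map_ofNat, map_one, frobenius_def]
    try linear_combination (2*z - z^3) * hz + (-z) * hp5
  refine ⟨h2, fun h => one_ne_zero (α := k) ?_⟩
  have h1' : -z = z := by rw [← h1]; simpa using h
  linear_combination (-2) * hz + (-z) * h1' + (1) * hp5

lemma fr3 {k : Type*} [Field k] [CharP k 5] (z : k) (hz : -1 - 2*z - z^2 + z^3 = 0) :
    z ^ 5 ^ 3 = z ∧ z ^ 5 ≠ z := by
  have hp5 : (5 : k) = 0 := by exact_mod_cast CharP.cast_eq_zero k 5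
  have : Fact (Nat.Prime 5) := ⟨by norm_num⟩
  have hs : ∀ (i : ℕ) (a : k), z ^ 5 ^ i = a → z ^ 5 ^ (i + 1) = frobenius k 5 a := by
    intro i a h
    rw [frobenius_def, ← h, ← pow_mul, pow_succ]
  have h0 : z ^ 5 ^ 0 = z := by simp
  have h1 : z ^ 5 ^ 1 = -2 + 2*z + z^2 := by
    rw [hs 0 _ h0]
    simp only [map_add, map_sub, map_neg, map_mul, map_pow, map_ofNat, map_one, frobenius_def]
    try linear_combination (-2 + z + z^2) * hz + (-z + z^3) * hp5
  have h2 : z ^ 5 ^ 2 = -2 + 2*z - z^2 := by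
    rw [hs 1 _ h1]
    simp only [map_add, map_sub, map_neg, map_mul, map_pow, map_ofNat, map_one, frobenius_def]
    try linear_combination (2*z - 2*z^3 + z^4 - 2*z^5 + z^6 + z^7) * hz + (z^2 - z^4 + z^8) * hp5
  have h3 : z ^ 5 ^ 3 = z := by
    rw [hs 2 _ h2]
    simp only [map_add, map_sub, map_neg, map_mul, map_pow, map_ofNat, map_one, frobenius_def]
    try linear_combination (2 + 2*z - z^2 + 2*z^3 - z^4 + 2*z^5 - z^6 - z^7) * hz + (z + z^2 + z^5 - z^8) * hp5
  refine ⟨h3, fun h => one_ne_zero (α := k) ?_⟩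
  have h1' : -2 + 2*z + z^2 = z := by rw [← h1]; simpa using h
  linear_combination (-1 - z) * hz + (-z + z^2) * h1' + (-z) * hp5

lemma fr11 {k : Type*} [Field k] [CharP k 5] (z : k) (hz : 2 - z + 2*z^2 + 2*z^3 - z^4 + 2*z^5 - z^7 + z^8 + z^11 = 0) :
    z ^ 5 ^ 11 = z ∧ z ^ 5 ≠ z := by
  have hp5 : (5 : k) = 0 := by exact_mod_cast CharP.cast_eq_zero k 5
  have : Fact (Nat.Prime 5) := ⟨by norm_num⟩
  have hs : ∀ (i : ℕ) (a : k), z ^ 5 ^ i = a → z ^ 5 ^ (i + 1) = frobenius k 5 a := by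
    intro i a h
    rw [frobenius_def, ← h, ← pow_mul, pow_succ]
  have h0 : z ^ 5 ^ 0 = z := by simp
  have h1 : z ^ 5 ^ 1 = z^5 := by
    rw [hs 0 _ h0]
    simp only [map_add, map_sub, map_neg, map_mul, map_pow, map_ofNat, map_one, frobenius_def]
    try linear_combination (0) * hz + (0) * hp5
  have h2 : z ^ 5 ^ 2 = -1 + z + z^4 - z^5 - 2*z^6 + 2*z^7 + 2*z^9 := by
    rw [hs 1 _ h1]
    simp only [map_add, map_sub, map_neg, map_mul, map_pow, map_ofNat, map_one, frobenius_def]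
    try linear_combination (-2 + z + z^3 - 2*z^4 + z^5 - z^6 - z^7 - z^8 + z^10 - z^11 + z^14) * hz + (1 - z + z^2 + z^6 + z^9 + z^11) * hp5
  have h3 : z ^ 5 ^ 3 = z + 2*z^2 + z^3 + 2*z^4 + 2*z^5 + z^6 - 2*z^7 - z^8 + z^9 - 2*z^10 := by
    rw [hs 2 _ h2]
    simp only [map_add, map_sub, map_neg, map_mul, map_pow, map_ofNat, map_one, frobenius_def]
    try linear_combination (2 - 2*z + z^2 + z^4 + z^5 - z^6 + z^7 + 2*z^8 - z^9 - 2*z^10 - z^11 + z^12 + 2*z^13 + 2*z^14 + 2*z^15 - z^16 - 2*z^17 + 2*z^18 - 2*z^19 - 2*z^20 + 2*z^23 - 2*z^24 + 2*z^25 - 2*z^26 - 2*z^27 - 2*z^28 + 2*z^30 - 2*z^31 + 2*z^34) * hz + (-1 + z - 2*z^2 - 2*z^5 + z^6 - z^7 - z^8 + z^9 - z^10 + z^12 - z^13 - z^15 - z^16 - z^17 - 2*z^18 + 2*z^19 + 3*z^22 - 2*z^23 + z^24 - z^25 + z^27 + 2*z^29 + 2*z^31) * hp5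
  have h4 : z ^ 5 ^ 4 = 1 + z - z^2 - z^4 - 2*z^5 + 2*z^6 - 2*z^7 - 2*z^8 + z^9 + 2*z^10 := by
    rw [hs 3 _ h3]
    simp only [map_add, map_sub, map_neg, map_mul, map_pow, map_ofNat, map_one, frobenius_def]
    try linear_combination (2 - 2*z + z^4 - z^5 + 2*z^6 - 2*z^7 - z^9 + z^10 - 2*z^11 + z^12 - 2*z^14 + 2*z^15 - 2*z^16 - 2*z^17 + z^19 - 2*z^20 + z^22 - 2*z^23 + z^24 - z^25 - 2*z^26 - z^27 + 2*z^28 - 2*z^29 - z^30 + z^31 + 2*z^32 + 2*z^33 + z^34 - 2*z^35 + 2*z^36 - 2*z^39) * hz + (-1 + z - z^2 + z^4 - z^6 + 2*z^7 - z^8 + z^10 + z^13 + z^14 - 2*z^15 + 3*z^16 - z^18 + 3*z^19 + z^20 - z^21 + 2*z^22 + z^23 - 2*z^24 + 3*z^25 + z^26 - z^27 + 2*z^28 + 2*z^29 - z^30 + z^31 + z^32 - 2*z^33 - 3*z^36 + z^37 - z^39 + z^40) * hp5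
  have h5 : z ^ 5 ^ 5 = -2 - z - z^2 - z^3 - 2*z^4 + z^5 - z^6 - 2*z^8 + 2*z^9 + 2*z^10 := by
    rw [hs 4 _ h4]
    simp only [map_add, map_sub, map_neg, map_mul, map_pow, map_ofNat, map_one, frobenius_def]
    try linear_combination (-1 - z^2 + z^3 + 2*z^4 + 2*z^5 - 2*z^6 + z^7 + 2*z^8 + 2*z^9 + 2*z^10 - 2*z^11 + 2*z^14 - z^16 + z^17 - 2*z^19 + z^20 - z^21 + 2*z^22 + 2*z^23 + z^24 - 2*z^26 - z^27 + z^28 - z^29 - 2*z^30 + 2*z^31 - 2*z^32 - 2*z^33 + z^34 + 2*z^35 - 2*z^36 + 2*z^39) * hz + (1 + z^2 - 2*z^7 - z^9 - 3*z^10 + z^11 - 2*z^12 - z^13 - z^15 - z^17 - 2*z^20 + 2*z^21 - z^22 - z^23 + z^24 - 3*z^25 - z^28 + 2*z^29 + z^30 - z^31 + 3*z^32 - z^33 - z^34 + 2*z^35 - z^37 + 2*z^38 - z^39 - z^40 + z^41 - z^42) * hp5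
  have h6 : z ^ 5 ^ 6 = 1 - 2*z^3 - z^4 + z^5 - 2*z^7 + 2*z^8 - 2*z^9 - z^10 := by
    rw [hs 5 _ h5]
    simp only [map_add, map_sub, map_neg, map_mul, map_pow, map_ofNat, map_one, frobenius_def]
    try linear_combination (1 - 2*z - 2*z^2 + z^3 - 2*z^4 + 2*z^5 - 2*z^6 - 2*z^7 + 2*z^8 - z^9 - 2*z^10 + 2*z^11 - z^13 + 2*z^14 + 2*z^16 - z^17 + z^20 - 2*z^21 + 2*z^22 - 2*z^23 + z^24 + z^25 + 2*z^26 - 2*z^27 - z^29 - z^30 + z^31 - 2*z^32 - 2*z^33 + 2*z^34 + 2*z^35 - 2*z^36 + 2*z^39) * hz + (-1 + z + 3*z^4 - 2*z^5 + 2*z^6 + 2*z^7 - 3*z^8 + 4*z^9 - 2*z^11 + 4*z^12 - z^13 - 2*z^14 + 3*z^15 - 3*z^16 + z^18 - 2*z^19 + z^21 - 2*z^22 + 2*z^23 - z^24 - z^25 + z^26 - z^27 - z^28 + z^29 - z^31 + 3*z^32 - z^34 + 2*z^35 - 2*z^37 + 2*z^38 - z^39 - z^40 + z^41 - z^42) *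 hp5
  have h7 : z ^ 5 ^ 7 = -1 + z^2 - 2*z^3 - 2*z^4 - z^5 - z^7 - 2*z^8 + 2*z^9 - z^10 := by
    rw [hs 6 _ h6]
    simp only [map_add, map_sub, map_neg, map_mul, map_pow, map_ofNat, map_one, frobenius_def]
    try linear_combination (1 - 2*z + 2*z^3 + 2*z^4 - 2*z^6 - z^7 + z^9 + 2*z^10 + z^11 + z^12 + 2*z^13 + z^14 + 2*z^15 - 2*z^16 + z^18 - 2*z^20 + z^21 - 2*z^22 - z^23 + 2*z^24 + 2*z^25 - z^26 + 2*z^27 + z^28 - z^29 + 2*z^30 - 2*z^31 + z^32 + z^33 - 2*z^34 - z^35 + z^36 - z^39) * hz + (z - z^2 + z^4 - z^5 - z^12 - 2*z^13 - z^14 - 3*z^15 - z^17 - z^18 + z^19 - z^20 - z^21 + 2*z^22 - z^23 - z^24 + 2*z^25 - z^26 - 2*z^27 + z^28 - z^29 - 3*z^30 + 3*z^31 - 2*z^32 - z^33 + 3*z^34 - 3*z^35 + 2*z^37 - 2*z^38 + z^39 + z^40 - z^41 + z^42) * hp5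
  have h8 : z ^ 5 ^ 8 = 2 + z + z^3 + z^5 + 2*z^6 + 2*z^7 - 2*z^8 + z^10 := by
    rw [hs 7 _ h7]
    simp only [map_add, map_sub, map_neg, map_mul, map_pow, map_ofNat, map_one, frobenius_def]
    try linear_combination (1 - z^2 - 2*z^3 - 2*z^4 - 2*z^5 - z^6 - 2*z^7 + z^8 - z^9 - z^10 - z^11 - z^12 + z^13 + z^14 + z^16 - z^17 - z^18 - 2*z^19 + 2*z^20 - 2*z^21 + 2*z^22 + 2*z^23 + 2*z^25 - z^26 - 2*z^27 + 2*z^28 + z^30 - z^31 + z^32 + z^33 + 2*z^34 - z^35 + z^36 - z^39) * hz + (-1 + z^4 + z^5 + z^6 + 2*z^7 + z^8 + 2*z^9 + z^10 + 2*z^12 + z^14 + z^15 - z^16 + z^17 + 2*z^21 - z^22 + z^24 - 4*z^25 + z^26 - 3*z^28 + 3*z^29 - z^30 - z^31 + z^32 - 2*z^33 - z^34 - 2*z^36 - z^39) * hp5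
  have h9 : z ^ 5 ^ 9 = -1 - z + z^2 + z^3 - 2*z^4 + 2*z^6 + 2*z^7 - z^8 - z^9 + 2*z^10 := by
    rw [hs 8 _ h8]
    simp only [map_add, map_sub, map_neg, map_mul, map_pow, map_ofNat, map_one, frobenius_def]
    try linear_combination (-1 - 2*z^2 + 2*z^3 + z^4 + 2*z^5 + z^6 - z^7 + z^8 + 2*z^10 + z^11 - 2*z^12 - 2*z^13 - z^14 - 2*z^15 + z^16 + 2*z^19 + z^20 + 2*z^21 + 2*z^22 - z^23 + 2*z^24 + z^25 - 2*z^26 + z^28 + z^29 + z^30 - z^31 - z^32 - z^33 + z^35 - z^36 + z^39) * hz + (1 + z^2 - z^3 + z^4 - 2*z^6 - 2*z^8 - z^10 - z^11 + z^12 - z^13 + 2*z^15 - z^16 + 2*z^17 + z^18 - 2*z^19 + z^20 - 2*z^21 - 2*z^22 + z^23 - 3*z^24 + z^26 - 3*z^27 + z^28 - 2*z^30 + z^31 - z^32 - z^33 + z^34 + z^36 - z^40) * hp5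
  have h10 : z ^ 5 ^ 10 = 1 + 2*z - 2*z^2 + 2*z^3 - 2*z^5 + z^6 + z^7 - 2*z^8 + 2*z^10 := by
    rw [hs 9 _ h9]
    simp only [map_add, map_sub, map_neg, map_mul, map_pow, map_ofNat, map_one, frobenius_def]
    try linear_combination (-1 + z - z^3 - 2*z^4 + 2*z^5 + z^7 - 2*z^8 - 2*z^9 + 2*z^10 - 2*z^11 + z^12 - 2*z^13 - z^14 + 2*z^16 + 2*z^17 - 2*z^18 + z^19 + 2*z^21 + z^22 - z^23 - z^24 - z^25 - z^26 + z^27 - 2*z^28 + z^30 - z^31 - 2*z^32 - 2*z^33 - z^34 + 2*z^35 - 2*z^36 + 2*z^39) * hz + (-z + z^2 + z^6 - z^7 + z^8 + z^9 - 2*z^10 + 3*z^11 - z^12 + z^13 + 2*z^14 - z^15 + z^16 - z^19 - z^21 - z^22 + z^23 - z^24 + z^26 - z^27 + 2*z^28 + 2*z^31 - z^32 + z^33 + 2*z^34 + 3*z^36 + z^39 - z^40) * hp5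
  have h11 : z ^ 5 ^ 11 = z := by
    rw [hs 10 _ h10]
    simp only [map_add, map_sub, map_neg, map_mul, map_pow, map_ofNat, map_one, frobenius_def]
    try linear_combination (-2 + z + z^3 + z^4 - 2*z^5 + z^6 + z^7 - 2*z^9 - z^12 + z^15 - 2*z^17 + 2*z^19 + z^20 + 2*z^22 + z^23 + z^24 - z^25 - z^26 + 2*z^28 - z^29 + 2*z^30 - 2*z^31 - 2*z^32 - 2*z^33 + 2*z^35 - 2*z^36 + 2*z^39) * hz + (1 - z + z^2 - z^4 + 2*z^5 - 2*z^6 + z^8 - z^9 + z^11 + z^14 + z^17 - z^18 + z^20 - z^21 - z^22 - 2*z^24 - z^25 - z^27 + z^29 - 2*z^30 + z^31 - z^33 + 2*z^34 + 2*z^36 - z^40) * hp5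
  refine ⟨h11, fun h => one_ne_zero (α := k) ?_⟩
  have h1' : z^5 = z := by rw [← h1]; simpa using h
  linear_combination (-2 + z + z^2 - 2*z^4) * hz + (-1 + 2*z + 2*z^2 + 2*z^3 - 2*z^4 - z^5 + 2*z^6 + z^7 - z^8 + 2*z^10) * h1' + (1 - z + z^2 + z^3 + z^9) * hp5

open Polynomial in
lemma roq5 {k : Type*} [Field k] (h5 : (5 : k) = 0) (hs : (pF (2 : k)).Splits) (h0 : pF (2 : k) ≠ 0) :
    ∃ z : k, 2 + 2*z - 2*z^2 - z^3 + z^4 + z^5 = 0 ∧ (pF (2 : k)).eval z = 0 := by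
  have h5' : (5 : k[X]) = 0 := by
    have := congrArg C h5
    simpa [map_ofNat] using this
  have e : pF (2 : k) = (2 + 2*X - 2*X^2 - X^3 + X^4 + X^5) * (-2*X - 2*X^2 - 2*X^3 + 2*X^4 + 2*X^5 - X^6 + X^7) := by
    simp only [pF, map_ofNat]
    linear_combination (3203072 + 308*X - 1442456*X^2 - 204*X^3 + 240690*X^4 + 36*X^5 - 20076*X^6 + 2*X^7 + 902*X^8 - X^9 - 21*X^10) * h5'
  have hd : (2 + 2*X - 2*X^2 - X^3 + X^4 + X^5 : k[X]) ∣ pF (2 : k) := ⟨_, e⟩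
  have hdeg : (2 + 2*X - 2*X^2 - X^3 + X^4 + X^5 : k[X]).natDegree = 5 := by
    compute_degree!
    all_goals simp [coeff_one]
  obtain ⟨z, hz⟩ := (hs.of_dvd h0 hd).exists_eval_eq_zero (by
    intro h; rw [degree_eq_natDegree (by intro h'; simp [h'] at hdeg), hdeg] at h; norm_cast at h)
  refine ⟨z, by simpa using hz, ?_⟩
  rw [e, eval_mul, hz, zero_mul]

open Polynomial in
lemma roq2 {k : Type*} [Field k] (h5 : (5 : k) = 0) (hs : (pF (3 : k)).Splits) (h0 : pF (3 : k) ≠ 0) :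
    ∃ z : k, 2 + z^2 = 0 ∧ (pF (3 : k)).eval z = 0 := by
  have h5' : (5 : k[X]) = 0 := by
    have := congrArg C h5
    simpa [map_ofNat] using this
  have e : pF (3 : k) = (2 + X^2) * (2*X - X^2 + X^3 + X^5 + 2*X^6 + 2*X^7 - 2*X^8 + X^10) := by
    simp only [pF, map_ofNat]
    linear_combination (3204608 + 460*X - 1443686*X^2 - 308*X^3 + 241037*X^4 + 57*X^5 - 20116*X^6 - X^7 + 904*X^8 - X^9 - 21*X^10) * h5'
  have hd : (2 + X^2 : k[X]) ∣ pF (3 : k) := ⟨_, e⟩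
  have hdeg : (2 + X^2 : k[X]).natDegree = 2 := by
    compute_degree!
    all_goals simp [coeff_one]
  obtain ⟨z, hz⟩ := (hs.of_dvd h0 hd).exists_eval_eq_zero (by
    intro h; rw [degree_eq_natDegree (by intro h'; simp [h'] at hdeg), hdeg] at h; norm_cast at h)
  refine ⟨z, by simpa using hz, ?_⟩
  rw [e, eval_mul, hz, zero_mul]

open Polynomial in
lemma roq3 {k : Type*} [Field k] (h5 : (5 : k) = 0) (hs : (pF (3 : k)).Splits) (h0 : pF (3 : k) ≠ 0) :
    ∃ z : k, -1 - 2*z - z^2 + z^3 = 0 ∧ (pF (3 : k)).eval z = 0 := by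
  have h5' : (5 : k[X]) = 0 := by
    have := congrArg C h5
    simpa [map_ofNat] using this
  have e : pF (3 : k) = (-1 - 2*X - X^2 + X^3) * (X + 2*X^4 - 2*X^5 - 2*X^6 - 2*X^7 + X^8 + X^9) := by
    simp only [pF, map_ofNat]
    linear_combination (3204608 + 461*X - 1443686*X^2 - 307*X^3 + 241037*X^4 + 58*X^5 - 20116*X^6 - 2*X^7 + 903*X^8 - 20*X^10) * h5'
  have hd : (-1 - 2*X - X^2 + X^3 : k[X]) ∣ pF (3 : k) := ⟨_, e⟩
  have hdeg : (-1 - 2*X - X^2 + X^3 : k[X]).natDegree = 3 := by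
    compute_degree!
    all_goals simp [coeff_one]
  obtain ⟨z, hz⟩ := (hs.of_dvd h0 hd).exists_eval_eq_zero (by
    intro h; rw [degree_eq_natDegree (by intro h'; simp [h'] at hdeg), hdeg] at h; norm_cast at h)
  refine ⟨z, by simpa using hz, ?_⟩
  rw [e, eval_mul, hz, zero_mul]

open Polynomial in
lemma roq11 {k : Type*} [Field k] (h5 : (5 : k) = 0) (hs : (pF (4 : k)).Splits) (h0 : pF (4 : k) ≠ 0) :
    ∃ z : k, 2 - z + 2*z^2 + 2*z^3 - z^4 + 2*z^5 - z^7 + z^8 + z^11 = 0 ∧ (pF (4 : k)).eval z = 0 := by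
  have h5' : (5 : k[X]) = 0 := by
    have := congrArg C h5
    simpa [map_ofNat] using this
  have e : pF (4 : k) = (2 - X + 2*X^2 + 2*X^3 - X^4 + 2*X^5 - X^7 + X^8 + X^11) * (X) := by
    simp only [pF, map_ofNat]
    linear_combination (3206144 + 614*X - 1444915*X^2 - 410*X^3 + 241382*X^4 + 77*X^5 - 20154*X^6 + 905*X^8 - X^9 - 21*X^10) * h5'
  have hd : (2 - X + 2*X^2 + 2*X^3 - X^4 + 2*X^5 - X^7 + X^8 + X^11 : k[X]) ∣ pF (4 : k) := ⟨_, e⟩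
  have hdeg : (2 - X + 2*X^2 + 2*X^3 - X^4 + 2*X^5 - X^7 + X^8 + X^11 : k[X]).natDegree = 11 := by
    compute_degree!
    all_goals simp [coeff_one]
  obtain ⟨z, hz⟩ := (hs.of_dvd h0 hd).exists_eval_eq_zero (by
    intro h; rw [degree_eq_natDegree (by intro h'; simp [h'] at hdeg), hdeg] at h; norm_cast at h)
  refine ⟨z, by simpa using hz, ?_⟩
  rw [e, eval_mul, hz, zero_mul]

open Polynomial in
lemma pF_map {A B : Type*} [CommRing A] [CommRing B] (φ : A →+* B) (r : A) : (pF r).map φ = pF (φ r) := by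
  simp [pF]

open Polynomial in
lemma pG_map {A B : Type*} [CommRing A] [CommRing B] (φ : A →+* B) (r : A) : (pG r).map φ = pG (φ r) := by
  simp [pG, map_ofNat]

open Polynomial in
lemma pF_form {A : Type*} [CommRing A] (r : A) : pF r = X ^ 12 + (C (-r) * X ^ 9 + C (-105) * X ^ 10 + C (6 * r) * X ^ 8 + C 4500 * X ^ 8
    + C (-192 * r) * X ^ 6 + C (-100000) * X ^ 6 + C (96 * r) * X ^ 5 + C (1728 * r) * X ^ 4 + C 1200000 * X ^ 4
    + C (-512 * r) * X ^ 3 + C (-6144 * r) * X ^ 2 + C (-7200000) * X ^ 2 + C (768 * r) * X + C (7680 * r + 16000000)) := by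
  simp only [pF, map_neg, map_mul, map_ofNat, map_add]
  ring

open Polynomial in
lemma pF_monic {A : Type*} [CommRing A] [Nontrivial A] (r : A) : (pF r).Monic ∧ (pF r).natDegree = 12 := by
  have h : (pF r).natDegree ≤ 12 := by
    rw [pF_form]; compute_degree
  have h1 : (pF r).coeff 12 = 1 := by
    rw [pF_form]; compute_degree!
  have h2 : (pF r).natDegree = 12 := natDegree_eq_of_le_of_coeff_ne_zero h (by simp [h1])
  exact ⟨by rw [Monic, leadingCoeff, h2, h1], h2⟩

open Polynomial in
lemma pG_monic {A : Type*} [CommRing A] [Nontrivial A] (r : A) : (pG r).Monic ∧ (pG r).natDegree = 11 := by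
  have h : (pG r).natDegree ≤ 11 := by
    unfold pG; compute_degree
  have h1 : (pG r).coeff 11 = 1 := by
    unfold pG; compute_degree!
  have h2 : (pG r).natDegree = 11 := natDegree_eq_of_le_of_coeff_ne_zero h (by simp [h1])
  exact ⟨by rw [Monic, leadingCoeff, h2, h1], h2⟩

open Polynomial in
lemma nodup_of_sep {L k : Type*} [Field k] (m : Multiset L) (ε : L → k) (P : k[X])
    (hP : P = ((m.map ε).map (fun a => X - C a)).prod)
    (hs : ∀ z, P.eval z = 0 → (derivative P).eval z = 0 → False) : (m.map ε).Nodup ∧ P.roots = m.map ε ∧ P.Splits := by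
  classical
  have h1 : P.roots = m.map ε := by rw [hP, roots_multiset_prod_X_sub_C]
  have h0 : P ≠ 0 := by
    intro h
    exact hs 0 (by simp [h]) (by simp [h])
  refine ⟨?_, h1, ?_⟩
  · rw [← h1, Multiset.nodup_iff_count_le_one]
    intro a
    rw [count_roots]
    by_contra h
    push Not at h
    rw [one_lt_rootMultiplicity_iff_isRoot h0] at h
    exact hs a h.1 h.2
  · rw [hP]
    exact Splits.multisetProd (by
      intro q hq
      obtain ⟨a, _, rfl⟩ := Multiset.mem_map.mp hq
      exact Splits.X_sub_C a)

noncomputable def rho : RatFunc ℚ := 4556250 / RatFunc.X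

open Polynomial in
lemma frobF (L : Type) [Field L] [Algebra (RatFunc ℚ) L] [FiniteDimensional (RatFunc ℚ) L] [IsGalois (RatFunc ℚ) L]
    (hs : (pF (algebraMap (RatFunc ℚ) L rho)).Splits) (p : ℕ) [Fact p.Prime] (r0 : ℤ) :
    ∃ (k : Type) (_ : Field k) (_ : CharP k p) (σ : L ≃ₐ[RatFunc ℚ] L) (ε : L → k),
      pF (r0 : k) = (((pF (algebraMap (RatFunc ℚ) L rho)).roots.map ε).map (fun a => X - C a)).prod ∧
      ∀ y, (pF (algebraMap (RatFunc ℚ) L rho)).IsRoot y → ε (σ y) = ε y ^ p := by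
  have := frob_int (RatFunc ℚ) L rho (gen_inj _ rho_trans) (gen_surj _ rho_mem) p r0 (pF X) (pF_monic X).1
    (by simpa [pF_map] using hs)
  simpa [pF_map] using this

open Polynomial in
lemma frobG (L : Type) [Field L] [Algebra (RatFunc ℚ) L] [FiniteDimensional (RatFunc ℚ) L] [IsGalois (RatFunc ℚ) L]
    (hs : (pG (algebraMap (RatFunc ℚ) L RatFunc.X)).Splits) :
    (pG (algebraMap (RatFunc ℚ) L RatFunc.X)).roots.Nodup := by
  have : Fact (Nat.Prime 3) := ⟨by norm_num⟩
  have := frob_int (RatFunc ℚ) L RatFunc.X (gen_inj _ tt_trans) (gen_surj _ (Subfield.subset_closure (by simp)))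
    3 1 (pG X) (pG_monic X).1 (by simpa [pG_map] using hs)
  obtain ⟨k, _, _, σ, ε, h1, -⟩ := this
  have h3 : (3 : k) = 0 := by exact_mod_cast CharP.cast_eq_zero k 3
  have := nodup_of_sep _ ε (pG (1 : k)) (by simpa [pG_map] using h1) (sepG h3)
  exact this.1.of_map

open Polynomial in
lemma frobF5 (L : Type) [Field L] [Algebra (RatFunc ℚ) L] [FiniteDimensional (RatFunc ℚ) L] [IsGalois (RatFunc ℚ) L]
    (hs : (pF (algebraMap (RatFunc ℚ) L rho)).Splits) (r0 : ℤ)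
    (hsep : ∀ (k : Type) [Field k], (5 : k) = 0 → ∀ z : k, (pF (r0 : k)).eval z = 0 →
      (derivative (pF (r0 : k))).eval z = 0 → False) :
    ∃ (k : Type) (_ : Field k) (_ : CharP k 5) (σ : L ≃ₐ[RatFunc ℚ] L) (ε : L → k),
      (pF (algebraMap (RatFunc ℚ) L rho)).roots.Nodup ∧ (pF (r0 : k)).Splits ∧ pF (r0 : k) ≠ 0 ∧
      (∀ z : k, (pF (r0 : k)).eval z = 0 → ∃ y, (pF (algebraMap (RatFunc ℚ) L rho)).IsRoot y ∧ ε y = z) ∧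
      (∀ y n, (pF (algebraMap (RatFunc ℚ) L rho)).IsRoot y → ((σ ^ n) y = y ↔ ε y ^ 5 ^ n = ε y)) := by
  have : Fact (Nat.Prime 5) := ⟨by norm_num⟩
  obtain ⟨k, hk, hc, σ, ε, h1, h2⟩ := frobF L hs 5 r0
  have h5 : (5 : k) = 0 := by exact_mod_cast CharP.cast_eq_zero k 5
  obtain ⟨e1, e2, e3⟩ := nodup_of_sep _ ε _ h1 (hsep k h5)
  have h0 : pF (r0 : k) ≠ 0 := (pF_monic _).1.ne_zero
  have hL : pF (algebraMap (RatFunc ℚ) L rho) ≠ 0 := (pF_monic _).1.ne_zero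
  refine ⟨k, hk, hc, σ, ε, e1.of_map, e3, h0, ?_, ?_⟩
  · intro z hz
    have : z ∈ (pF (r0 : k)).roots := (mem_roots h0).mpr hz
    rw [e2] at this
    obtain ⟨y, hy, rfl⟩ := Multiset.mem_map.mp this
    exact ⟨y, isRoot_of_mem_roots hy, rfl⟩
  · intro y n hy
    have hinj := Multiset.inj_on_of_nodup_map e1
    have hst : ∀ s : L ≃ₐ[RatFunc ℚ] L, ∀ y, (pF (algebraMap (RatFunc ℚ) L rho)).IsRoot y →
        (pF (algebraMap (RatFunc ℚ) L rho)).IsRoot (s y) := by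
      intro s y hy
      have := congrArg s hy
      rw [IsRoot, pF_eval] at *
      simpa [map_ofNat] using this
    have hn : ∀ n : ℕ, ε ((σ ^ n) y) = ε y ^ 5 ^ n := by
      intro n
      induction n with
      | zero => simp
      | succ n ih =>
        rw [pow_succ', AlgEquiv.mul_apply, h2 _ (hst _ _ hy), ih, ← pow_mul, ← pow_succ]
    constructor
    · intro h; rw [← hn, h]
    · intro h
      apply hinj _ ((mem_roots hL).mpr (hst _ _ hy)) _ ((mem_roots hL).mpr hy)
      rw [hn, h]

open Polynomial in
lemma el5 (L : Type) [Field L] [Algebra (RatFunc ℚ) L] [FiniteDimensional (RatFunc ℚ) L] [IsGalois (RatFunc ℚ) L]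
    (hs : (pF (algebraMap (RatFunc ℚ) L rho)).Splits) :
    ∃ (σ : L ≃ₐ[RatFunc ℚ] L) (a b y : L), (pF (algebraMap (RatFunc ℚ) L rho)).IsRoot a ∧
      (pF (algebraMap (RatFunc ℚ) L rho)).IsRoot b ∧ (pF (algebraMap (RatFunc ℚ) L rho)).IsRoot y ∧
      a ≠ b ∧ σ a = a ∧ σ b = b ∧ (σ ^ 5) y = y ∧ σ y ≠ y := by
  obtain ⟨k, _, _, σ, ε, h1, h2, h3, h4, h5⟩ := frobF5 L hs 2 (by
    intro k _ h5 z
    exact_mod_cast sepF2 h5 z)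
  have hp : (5 : k) = 0 := by exact_mod_cast CharP.cast_eq_zero k 5
  simp only [Int.cast_ofNat] at h2 h3 h4 h5
  obtain ⟨z, hz, hz'⟩ := roq5 hp h2 h3
  obtain ⟨y, hy, rfl⟩ := h4 z hz'
  obtain ⟨a, ha, ha'⟩ := h4 0 (by rw [pF_eval]; linear_combination 3203072 * hp)
  obtain ⟨b, hb, hb'⟩ := h4 (-1) (by rw [pF_eval]; linear_combination (1981970) * hp)
  have hf := fr5 _ hz
  refine ⟨σ, a, b, y, ha, hb, hy, ?_, ?_, ?_, (h5 y 5 hy).mpr hf.1, ?_⟩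
  · rintro rfl
    rw [ha'] at hb'
    exact one_ne_zero (α := k) (by linear_combination hb')
  · have := (h5 a 1 ha).mpr (by simp [ha'])
    simpa using this
  · have := (h5 b 1 hb).mpr (by rw [hb']; norm_num)
    simpa using this
  · intro h
    have := (h5 y 1 hy).mp (by simpa using h)
    exact hf.2 (by simpa using this)

open Polynomial in
lemma el3 (L : Type) [Field L] [Algebra (RatFunc ℚ) L] [FiniteDimensional (RatFunc ℚ) L] [IsGalois (RatFunc ℚ) L]
    (hs : (pF (algebraMap (RatFunc ℚ) L rho)).Splits) :
    ∃ (σ : L ≃ₐ[RatFunc ℚ] L) (a b y : L), (pF (algebraMap (RatFunc ℚ) L rho)).IsRoot a ∧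
      (pF (algebraMap (RatFunc ℚ) L rho)).IsRoot b ∧ (pF (algebraMap (RatFunc ℚ) L rho)).IsRoot y ∧
      a ≠ b ∧ σ a = a ∧ σ b = b ∧ (σ ^ 3) y = y ∧ σ y ≠ y := by
  obtain ⟨k, _, _, σ, ε, h1, h2, h3, h4, h5⟩ := frobF5 L hs 3 (by
    intro k _ h5 z
    exact_mod_cast sepF3 h5 z)
  have hp : (5 : k) = 0 := by exact_mod_cast CharP.cast_eq_zero k 5
  simp only [Int.cast_ofNat] at h2 h3 h4 h5
  obtain ⟨z, hz, hz'⟩ := roq3 hp h2 h3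
  obtain ⟨y, hy, rfl⟩ := h4 z hz'
  obtain ⟨z, hzb, hzb'⟩ := roq2 hp h2 h3
  obtain ⟨b, hb, rfl⟩ := h4 z hzb'
  obtain ⟨a, ha, ha'⟩ := h4 0 (by rw [pF_eval]; linear_combination 3204608 * hp)
  have hf := fr3 _ hz
  have hfb := fr2 _ hzb
  have h33 : (σ ^ 3) y = y := (h5 y 3 hy).mpr hf.1
  refine ⟨σ ^ 2, a, b, y, ha, hb, hy, ?_, ?_, ?_, ?_, ?_⟩
  · rintro rfl
    rw [ha'] at hfb
    simp at hfb
  · exact (h5 a 2 ha).mpr (by simp [ha'])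
  · exact (h5 b 2 hb).mpr hfb.1
  · have : (σ ^ 2) ^ 3 = σ ^ 3 * σ ^ 3 := by group
    rw [this, AlgEquiv.mul_apply, h33, h33]
  · intro h
    have h6 : σ y = y := by
      have : σ ^ 3 = σ * σ ^ 2 := by group
      rw [this, AlgEquiv.mul_apply, h] at h33
      exact h33
    have := (h5 y 1 hy).mp (by simpa using h6)
    exact hf.2 (by simpa using this)

open Polynomial in
lemma el11 (L : Type) [Field L] [Algebra (RatFunc ℚ) L] [FiniteDimensional (RatFunc ℚ) L] [IsGalois (RatFunc ℚ) L]
    (hs : (pF (algebraMap (RatFunc ℚ) L rho)).Splits) :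
    (pF (algebraMap (RatFunc ℚ) L rho)).roots.Nodup ∧
    ∃ (σ : L ≃ₐ[RatFunc ℚ] L) (y : L), (pF (algebraMap (RatFunc ℚ) L rho)).IsRoot y ∧
      (σ ^ 11) y = y ∧ σ y ≠ y := by
  obtain ⟨k, _, _, σ, ε, h1, h2, h3, h4, h5⟩ := frobF5 L hs 4 (by
    intro k _ h5 z
    exact_mod_cast sepF4 h5 z)
  have hp : (5 : k) = 0 := by exact_mod_cast CharP.cast_eq_zero k 5
  simp only [Int.cast_ofNat] at h2 h3 h4 h5
  obtain ⟨z, hz, hz'⟩ := roq11 hp h2 h3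
  obtain ⟨y, hy, rfl⟩ := h4 z hz'
  have hf := fr11 _ hz
  refine ⟨h1, σ, y, hy, (h5 y 11 hy).mpr hf.1, ?_⟩
  intro h
  have := (h5 y 1 hy).mp (by simpa using h)
  exact hf.2 (by simpa using this)

open Polynomial in
lemma elno (L : Type) [Field L] [Algebra (RatFunc ℚ) L] [FiniteDimensional (RatFunc ℚ) L] [IsGalois (RatFunc ℚ) L]
    (hs : (pF (algebraMap (RatFunc ℚ) L rho)).Splits) :
    ∃ (σ : L ≃ₐ[RatFunc ℚ] L), ∀ y, (pF (algebraMap (RatFunc ℚ) L rho)).IsRoot y → σ y ≠ y := by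
  have : Fact (Nat.Prime 7) := ⟨by norm_num⟩
  obtain ⟨k, _, _, σ, ε, h1, h2⟩ := frobF L hs 7 1
  have hp : (7 : k) = 0 := by exact_mod_cast CharP.cast_eq_zero k 7
  simp only [Int.cast_one] at h1
  refine ⟨σ, fun y hy h => ?_⟩
  have hL : pF (algebraMap (RatFunc ℚ) L rho) ≠ 0 := (pF_monic _).1.ne_zero
  refine nofix hp (ε y) ?_ (by rw [← h2 y hy, h])
  have : ε y ∈ (pF (1 : k)).roots := by
    rw [h1, roots_multiset_prod_X_sub_C]
    exact Multiset.mem_map_of_mem _ ((mem_roots hL).mpr hy)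
  exact isRoot_of_mem_roots this

lemma dvd_ord {G Y : Type*} [Group G] [MulAction G Y] (s : G) (y : Y) (q : ℕ) (hq : q.Prime)
    (h1 : s ^ q • y = y) (h2 : s • y ≠ y) : q ∣ orderOf s := by
  have e1 : MulAction.period s y ∣ q := MulAction.pow_smul_eq_iff_period_dvd.mp h1
  have e2 : MulAction.period s y ≠ 1 := by
    intro h
    apply h2
    have := MulAction.pow_smul_eq_iff_period_dvd (m := s) (a := y) (n := 1)
    rw [h] at this
    simpa using this
  rcases (Nat.dvd_prime hq).mp e1 with h | h
  · exact absurd h e2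
  · rw [← h]; exact MulAction.period_dvd_orderOf s y

lemma two_tr {G Y : Type*} [Group G] [MulAction G Y] [Fintype Y] [DecidableEq Y] (hY : Fintype.card Y = 12)
    (s r : G) (y0 : Y) (h1 : s ^ 11 • y0 = y0) (h2 : s • y0 ≠ y0) (h3 : ∀ y : Y, r • y ≠ y) :
    ∀ a b c d : Y, a ≠ b → c ≠ d → ∃ x : G, x • a = c ∧ x • b = d := by
  have hper : MulAction.period s y0 = 11 := by
    have e1 : MulAction.period s y0 ∣ 11 := MulAction.pow_smul_eq_iff_period_dvd.mp h1
    rcases (Nat.dvd_prime (by norm_num : Nat.Prime 11)).mp e1 with h | h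
    · exfalso
      apply h2
      have := MulAction.pow_smul_eq_iff_period_dvd (m := s) (a := y0) (n := 1)
      rw [h] at this
      simpa using this
    · exact h
  set O : Finset Y := (Finset.range 11).image (fun i => s ^ i • y0) with hO
  have hOc : O.card = 11 := by
    rw [hO, Finset.card_image_of_injOn, Finset.card_range]
    intro i hi j hj hij
    simp only [Finset.coe_range, Set.mem_Iio] at hi hj
    dsimp only at hij
    wlog hle : i ≤ j generalizing i j
    · exact (this hij.symm hj hi (by omega)).symm
    have : s ^ (j - i) • y0 = y0 := by
      have e : s ^ j = s ^ i * s ^ (j - i) := by rw [← pow_add]; congr 1; omega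
      rw [e, mul_smul] at hij
      exact (smul_left_cancel _ hij).symm
    have := MulAction.pow_smul_eq_iff_period_dvd.mp this
    rw [hper] at this
    have := Nat.eq_zero_of_dvd_of_lt this (by omega)
    omega
  have hcomp : Oᶜ.card = 1 := by rw [Finset.card_compl, hY, hOc]
  obtain ⟨z, hz⟩ := Finset.card_eq_one.mp hcomp
  have hmem : ∀ y, y ≠ z → ∃ i : ℕ, s ^ i • y0 = y := by
    intro y hy
    have : y ∈ O := by
      by_contra h
      have : y ∈ Oᶜ := Finset.mem_compl.mpr h
      rw [hz, Finset.mem_singleton] at this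
      exact hy this
    obtain ⟨i, _, hi⟩ := Finset.mem_image.mp this
    exact ⟨i, hi⟩
  have hz0 : ∀ i : ℕ, s ^ i • y0 ≠ z := by
    intro i h
    have hzO : z ∉ O := by
      rw [← Finset.mem_compl, hz]; simp
    apply hzO
    rw [← h, ← Nat.mod_add_div i 11, pow_add, pow_mul, mul_smul]
    have : ∀ n : ℕ, (s ^ 11) ^ n • y0 = y0 := by
      intro n
      induction n with
      | zero => simp
      | succ n ih => rw [pow_succ, mul_smul, h1, ih]
    rw [this]
    exact Finset.mem_image_of_mem _ (Finset.mem_range.mpr (Nat.mod_lt _ (by norm_num)))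
  have hsz : ∀ i : ℕ, s ^ i • z = z := by
    have h : s • z = z := by
      by_contra h
      obtain ⟨i, hi⟩ := hmem _ h
      have : s ^ (i + 10) • y0 = z := by
        have e : s • (s ^ (i + 10) • y0) = s • z := by
          rw [← hi, ← mul_smul, ← pow_succ', show i + 10 + 1 = i + 11 by ring, pow_add, mul_smul, h1]
        exact smul_left_cancel _ e
      exact hz0 _ this
    intro i
    induction i with
    | zero => simp
    | succ n ih => rw [pow_succ, mul_smul, h, ih]
  have htr : ∀ a : Y, ∃ x : G, x • a = z := by
    intro a
    obtain ⟨j, hj⟩ := hmem (r • z) (h3 z)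
    by_cases ha : a = z
    · exact ⟨1, by simp [ha]⟩
    · obtain ⟨i, hi⟩ := hmem a ha
      refine ⟨r⁻¹ * s ^ j * (s ^ i)⁻¹, ?_⟩
      rw [← hi, mul_smul, inv_smul_smul, mul_smul, hj, inv_smul_smul]
  have hpair : ∀ a b : Y, a ≠ b → ∃ x : G, x • a = z ∧ x • b = y0 := by
    intro a b hab
    obtain ⟨x, hx⟩ := htr a
    have hb : x • b ≠ z := by
      rw [← hx]; intro h; exact hab (smul_left_cancel _ h).symm
    obtain ⟨i, hi⟩ := hmem _ hb
    refine ⟨(s ^ i)⁻¹ * x, ?_, ?_⟩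
    · rw [mul_smul, hx, inv_smul_eq_iff, hsz]
    · rw [mul_smul, ← hi, inv_smul_smul]
  intro a b c d hab hcd
  obtain ⟨x, hx1, hx2⟩ := hpair a b hab
  obtain ⟨x', hx1', hx2'⟩ := hpair c d hcd
  refine ⟨x'⁻¹ * x, ?_, ?_⟩
  · rw [mul_smul, hx1, inv_smul_eq_iff, hx1']
  · rw [mul_smul, hx2, inv_smul_eq_iff, hx2']


open Polynomial in
def rootsAct {K L : Type} [Field K] [Field L] [Algebra K L] (p : L[X])
    (hp : ∀ (s : L ≃ₐ[K] L) (y : L), p.IsRoot y → p.IsRoot (s y)) : SubMulAction (L ≃ₐ[K] L) L where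
  carrier := {y | p.IsRoot y}
  smul_mem' := fun s y hy => hp s y hy

open Polynomial in
lemma root_inv {K L : Type} [Field K] [Field L] [Algebra K L] (q : K[X]) (s : L ≃ₐ[K] L) (y : L)
    (h : (q.map (algebraMap K L)).IsRoot y) : (q.map (algebraMap K L)).IsRoot (s y) := by
  rw [IsRoot.def, eval_map_algebraMap] at *
  have : aeval ((s : L →ₐ[K] L) y) q = (s : L →ₐ[K] L) (aeval y q) := Polynomial.aeval_algHom_apply _ _ _
  rw [h, map_zero] at this
  exact this

open Polynomial in
lemma rootsAct_card {K L : Type} [Field K] [Field L] [Algebra K L] (p : L[X])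
    (hp : ∀ (s : L ≃ₐ[K] L) (y : L), p.IsRoot y → p.IsRoot (s y)) (h0 : p ≠ 0) (hs : p.Splits)
    (hn : p.roots.Nodup) : Nat.card (rootsAct p hp) = p.natDegree ∧ Finite (rootsAct p hp) := by
  classical
  have e : ∀ y, y ∈ rootsAct p hp ↔ y ∈ p.roots.toFinset := by
    intro y
    rw [Multiset.mem_toFinset, mem_roots h0]; rfl
  have e2 : rootsAct p hp ≃ p.roots.toFinset := Equiv.subtypeEquivRight e
  refine ⟨?_, Finite.of_equiv _ e2.symm⟩
  rw [Nat.card_congr e2, Nat.card_eq_fintype_card, Fintype.card_coe, Multiset.toFinset_card_of_nodup hn]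
  exact hs.natDegree_eq_card_roots.symm

open Polynomial in
lemma final (L : Type) [Field L] [CharZero L] [Algebra (RatFunc ℚ) L] [FiniteDimensional (RatFunc ℚ) L]
    [IsGalois (RatFunc ℚ) L]
    (hF : (pF (algebraMap (RatFunc ℚ) L rho)).Splits)
    (hG : (pG (algebraMap (RatFunc ℚ) L RatFunc.X)).Splits)
    (hgen : ∀ s : L ≃ₐ[RatFunc ℚ] L,
      (∀ x, (pG (algebraMap (RatFunc ℚ) L RatFunc.X)).IsRoot x → s x = x) →
      (∀ y, (pF (algebraMap (RatFunc ℚ) L rho)).IsRoot y → s y = y) → s = 1) :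
    Nat.card (L ≃ₐ[RatFunc ℚ] L) = 7920 ∧ IsSimpleGroup (L ≃ₐ[RatFunc ℚ] L) ∧
    ∀ s : L ≃ₐ[RatFunc ℚ] L,
      (∀ x, (pG (algebraMap (RatFunc ℚ) L RatFunc.X)).IsRoot x → s x = x) → s = 1 := by
  classical
  have hFi : ∀ (s : L ≃ₐ[RatFunc ℚ] L) (y : L), (pF (algebraMap (RatFunc ℚ) L rho)).IsRoot y →
      (pF (algebraMap (RatFunc ℚ) L rho)).IsRoot (s y) := by
    intro s y h
    have := root_inv (pF rho) s y
    rw [pF_map] at this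
    exact this h
  have hGi : ∀ (s : L ≃ₐ[RatFunc ℚ] L) (y : L), (pG (algebraMap (RatFunc ℚ) L RatFunc.X)).IsRoot y →
      (pG (algebraMap (RatFunc ℚ) L RatFunc.X)).IsRoot (s y) := by
    intro s y h
    have := root_inv (pG RatFunc.X) s y
    rw [pG_map] at this
    exact this h
  have hT : Transcendental ℚ (algebraMap (RatFunc ℚ) L RatFunc.X) := by
    rintro ⟨p, hp, h⟩
    refine tt_trans ⟨p, hp, (algebraMap (RatFunc ℚ) L).injective ?_⟩
    rw [aeval_def] at h ⊢
    rw [map_zero, hom_eval₂, ← h]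
    congr 1
    exact RingHom.ext_rat _ _
  have hR : algebraMap (RatFunc ℚ) L rho = 4556250 / algebraMap (RatFunc ℚ) L RatFunc.X := by
    rw [rho, map_div₀, map_ofNat]
  have hTs : ∀ s : L ≃ₐ[RatFunc ℚ] L, s (algebraMap (RatFunc ℚ) L RatFunc.X) = algebraMap (RatFunc ℚ) L RatFunc.X :=
    fun s => s.commutes _
  have nF := (el11 L hF).1
  have nG := frobG L hG
  obtain ⟨mF, dF⟩ := pF_monic (algebraMap (RatFunc ℚ) L rho)
  obtain ⟨mG, dG⟩ := pG_monic (algebraMap (RatFunc ℚ) L RatFunc.X)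
  obtain ⟨_, s11, y11, r11, p11, q11⟩ := el11 L hF
  obtain ⟨sno, hno⟩ := elno L hF
  obtain ⟨s3, a3, b3, y3, ra3, rb3, ry3, n3, fa3, fb3, p3, q3⟩ := el3 L hF
  obtain ⟨s5, a5, b5, y5, ra5, rb5, ry5, n5, fa5, fb5, p5, q5⟩ := el5 L hF
  have dne : ∀ y, (pF (algebraMap (RatFunc ℚ) L rho)).IsRoot y →
      (pF (algebraMap (RatFunc ℚ) L rho)).derivative.eval y ≠ 0 := by
    intro y hy h
    have h1 := (one_lt_rootMultiplicity_iff_isRoot mF.ne_zero).mpr ⟨hy, h⟩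
    rw [← count_roots] at h1
    have := Multiset.nodup_iff_count_le_one.mp nF y
    omega
  set T := algebraMap (RatFunc ℚ) L RatFunc.X with hTdef
  set R := algebraMap (RatFunc ℚ) L rho with hRdef
  clear_value T R
  obtain ⟨cX, fX⟩ := rootsAct_card _ hGi mG.ne_zero hG nG
  obtain ⟨cY, fY⟩ := rootsAct_card _ hFi mF.ne_zero hF nF
  have FX : Fintype (rootsAct (pG T) hGi) := Fintype.ofFinite _
  have FY : Fintype (rootsAct (pF R) hFi) := Fintype.ofFinite _
  rw [dG, Nat.card_eq_fintype_card] at cX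
  rw [dF, Nat.card_eq_fintype_card] at cY
  have th : ∀ x : rootsAct (pG T) hGi, ww T x.1 ^ 2 = 5*(x.1+1)*(x.1^2-8*x.1+720) ∧
      u0 x.1 ^ 2 * (4556250 / T) = RR x.1 (ww T x.1) ∧ u0 x.1 ≠ 0 := by
    intro x
    apply theta x.1 T hT
    have := x.2
    change (pG T).eval x.1 = 0 at this
    simp only [pG, eval_sub, eval_mul, eval_add, eval_pow, eval_C, eval_X, eval_one, eval_ofNat] at this
    rw [← this, gC, gB]
    ring
  have key : ∀ x : rootsAct (pG T) hGi, ∃ e : rootsAct (pF R) hFi → ℤ, (∀ y, e y = 1 ∨ e y = -1) ∧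
      ∑ y, e y = 0 ∧ ∀ y y', (e y * e y' = 1 ∨ e y * e y' = -1) ∧
      (e y * e y' = 1 ↔ (pU x.1 (ww T x.1)).eval y.1 * (pV x.1 (ww T x.1)).eval y'.1 =
        (pU x.1 (ww T x.1)).eval y'.1 * (pV x.1 (ww T x.1)).eval y.1) := by
    intro x
    obtain ⟨h1, h2, h3⟩ := th x
    rw [← hR] at h2
    exact sgn _ _ (pF R) (u0 x.1) (5 * (x.1 + 1)) h3 (pF_cert x.1 (ww T x.1) R h1 h2) (pU_deg _ _)
      (pU_coeff _ _) (pV_deg _ _) cY (fun y => y.1) Subtype.val_injective (fun y => y.2)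
      (fun y => dne _ y.2) ⟨y11, r11⟩
  choose e he1 he2 he3 using key
  have hws : ∀ (s : L ≃ₐ[RatFunc ℚ] L) (x : L), ww T (s x) = s (ww T x) := by
    intro s x
    simp only [ww, gB, sS, map_div₀, map_mul, map_add, map_sub, map_pow, map_ofNat, map_one, hTs]
  have main := lemG (G := L ≃ₐ[RatFunc ℚ] L) cX cY e he1 he2 ?_ ?_ ?_ ?_ ?_
  · refine ⟨main.1, main.2.1, fun s hs => main.2.2 s fun x => Subtype.ext (hs x.1 x.2)⟩
  · intro s x y y'
    obtain ⟨a1, a2⟩ := he3 (s • x) (s • y) (s • y')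
    obtain ⟨b1, b2⟩ := he3 x y y'
    have iff1 : e (s • x) (s • y) * e (s • x) (s • y') = 1 ↔ e x y * e x y' = 1 := by
      rw [a2, b2]
      change (pU (s x.1) (ww T (s x.1))).eval (s y.1) * (pV (s x.1) (ww T (s x.1))).eval (s y'.1) =
        (pU (s x.1) (ww T (s x.1))).eval (s y'.1) * (pV (s x.1) (ww T (s x.1))).eval (s y.1) ↔ _
      rw [hws]
      have eU := fun y => pU_eval_map (s : L →+* L) x.1 (ww T x.1) y
      have eV := fun y => pV_eval_map (s : L →+* L) x.1 (ww T x.1) y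
      simp only [RingHom.coe_coe] at eU eV
      rw [eU, eU, eV, eV, ← map_mul, ← map_mul]
      exact s.injective.eq_iff
    rcases a1 with a1 | a1 <;> rcases b1 with b1 | b1
    · rw [a1, b1]
    · have := iff1.mp a1; omega
    · have := iff1.mpr b1; omega
    · rw [a1, b1]
  · intro s h1 h2
    exact hgen s (fun x hx => congrArg Subtype.val (h1 ⟨x, hx⟩)) (fun x hx => congrArg Subtype.val (h2 ⟨x, hx⟩))
  · refine two_tr cY s11 sno ⟨y11, r11⟩ (Subtype.ext p11) (fun h => q11 (congrArg Subtype.val h))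
      (fun y h => hno y.1 y.2 (congrArg Subtype.val h))
  · refine ⟨s3, ⟨a3, ra3⟩, ⟨b3, rb3⟩, fun h => n3 (congrArg Subtype.val h), Subtype.ext fa3, Subtype.ext fb3, ?_⟩
    exact dvd_ord s3 y3 3 (by norm_num) p3 q3
  · refine ⟨s5, ⟨a5, ra5⟩, ⟨b5, rb5⟩, fun h => n5 (congrArg Subtype.val h), Subtype.ext fa5, Subtype.ext fb5, ?_⟩
    exact dvd_ord s5 y5 5 (by norm_num) p5 q5

open Polynomial in
lemma g_eq : g = C (1 / 20) * pG (RatFunc.X : RatFunc ℚ) := by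
  have h : (C (1 / 20 : RatFunc ℚ)) * C 20 = 1 := by
    rw [← C_mul]; norm_num
  rw [g, pG, t, C_mul, C_mul, C_pow]
  linear_combination (C RatFunc.X * ((X + 1) *
      (7 * X ^ 7 - 132 * X ^ 6 + 6912 * X ^ 5 - 74352 * X ^ 4 + 822272 * X ^ 3 -
        1104000 * X ^ 2 - 22464000 * X - 24883200)) + C RatFunc.X ^ 2 * (X ^ 5 * (X - 8))) * h

open Polynomial in
lemma main_thm : g.natDegree = 11 ∧ IsSimpleGroup g.Gal ∧ Nat.card g.Gal = 7920 := by
  have c20 : (1 / 20 : RatFunc ℚ) ≠ 0 := by norm_num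
  have hd : g.natDegree = 11 := by
    rw [g_eq, natDegree_C_mul c20, (pG_monic _).2]
  refine ⟨hd, ?_⟩
  let P : (RatFunc ℚ)[X] := pF rho * pG RatFunc.X
  have hP0 : P ≠ 0 := mul_ne_zero (pF_monic _).1.ne_zero (pG_monic _).1.ne_zero
  let L := P.SplittingField
  have : CharZero L := charZero_of_injective_algebraMap (algebraMap (RatFunc ℚ) L).injective
  have : Normal (RatFunc ℚ) L := Normal.of_isSplittingField P
  have : IsGalois (RatFunc ℚ) L := {}
  have hsp : (P.map (algebraMap (RatFunc ℚ) L)).Splits := SplittingField.splits P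
  have hm0 : P.map (algebraMap (RatFunc ℚ) L) ≠ 0 := by
    rwa [Polynomial.map_ne_zero_iff (algebraMap (RatFunc ℚ) L).injective]
  have hPm : P.map (algebraMap (RatFunc ℚ) L) = pF (algebraMap (RatFunc ℚ) L rho) * pG (algebraMap (RatFunc ℚ) L RatFunc.X) := by
    rw [Polynomial.map_mul, pF_map, pG_map]
  have hF : (pF (algebraMap (RatFunc ℚ) L rho)).Splits := hsp.of_dvd hm0 (hPm ▸ dvd_mul_right _ _)
  have hG : (pG (algebraMap (RatFunc ℚ) L RatFunc.X)).Splits := hsp.of_dvd hm0 (hPm ▸ dvd_mul_left _ _)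
  have hgm : g.map (algebraMap (RatFunc ℚ) L) = C (algebraMap (RatFunc ℚ) L (1/20)) * pG (algebraMap (RatFunc ℚ) L RatFunc.X) := by
    rw [g_eq, Polynomial.map_mul, pG_map, map_C]
  have hg0 : g.map (algebraMap (RatFunc ℚ) L) ≠ 0 := by
    rw [hgm]
    refine mul_ne_zero ?_ (pG_monic _).1.ne_zero
    rw [C_ne_zero]
    exact (_root_.map_ne_zero _).mpr c20
  obtain ⟨f1, f2, f3⟩ := final L hF hG (by
    intro s h1 h2
    have ht := SplittingField.adjoin_rootSet P
    have hh : (s : L →ₐ[RatFunc ℚ] L) = AlgHom.id _ _ := by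
      refine AlgHom.ext_of_adjoin_eq_top ht ?_
      intro x hx
      rw [mem_rootSet'] at hx
      have hx2 : (P.map (algebraMap (RatFunc ℚ) L)).eval x = 0 := by
        rw [eval_map_algebraMap]; exact hx.2
      rw [hPm, eval_mul, mul_eq_zero] at hx2
      rcases hx2 with h | h
      · exact h2 x h
      · exact h1 x h
    ext x
    exact DFunLike.congr_fun hh x)
  have hgs : (g.map (algebraMap (RatFunc ℚ) L)).Splits := by
    rw [hgm]; exact (Splits.C _).mul hG
  have : Fact ((g.map (algebraMap (RatFunc ℚ) L)).Splits) := ⟨hgs⟩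
  have hbij : Function.Bijective (Polynomial.Gal.restrict g L) := by
    refine ⟨?_, Polynomial.Gal.restrict_surjective g L⟩
    rw [injective_iff_map_eq_one]
    intro s hs
    apply f3
    intro x hx
    have hxm : x ∈ g.rootSet L := by
      rw [mem_rootSet']
      refine ⟨hg0, ?_⟩
      rw [← eval_map_algebraMap, hgm, eval_mul]
      rw [IsRoot.def] at hx
      rw [hx, mul_zero]
    have := Polynomial.Gal.restrict_smul (p := g) s (⟨x, hxm⟩ : g.rootSet L)
    rw [hs, one_smul] at this
    exact this.symm
  let E := MulEquiv.ofBijective _ hbij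
  refine ⟨MulEquiv.isSimpleGroup E.symm, ?_⟩
  rw [← f1]
  exact (Nat.card_congr E.toEquiv).symm

theorem m11_deg11_g : g.natDegree = 11 ∧ IsSimpleGroup g.Gal ∧ Nat.card g.Gal = 7920 := by
  exact main_thm
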